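/- arXiv:2605.23884 — 3 statements merged into one kernel-verified Lean document; each statement's English description precedes it below -/
import Mathlib

section
/- Let μ be a positive tempered measure on ℝ^d whose distributional Fourier transform μ̂ is a measure. Then μ is a translation-bounded measure, and μ̂ is translation bounded as a tempered distribution. -/
set_option linter.unusedSectionVars false

open MeasureTheory Filter Metric Complex SchwartzMap
open scoped Topology ENNReal NNReal ComplexConjugate

noncomputable section

section Preamble

variable {E : Type*} [NormedAddCommGroup E] [InnerProductSpace ℝ E] [FiniteDimensional ℝ E]
  [MeasurableSpace E] [BorelSpace E]

/-- A set is relatively dense if it has bounded gaps. -/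
def IsRelativelyDense (A : Set E) : Prop :=
  ∃ r : ℝ, ∀ x : E, ∃ a ∈ A, dist x a ≤ r

/-- Bohr almost periodic functions: uniformly continuous, bounded, with relatively
dense sets of ε-almost periods. -/
def IsBohrAP (f : E → ℂ) : Prop :=
  UniformContinuous f ∧ (∃ C : ℝ, ∀ x, ‖f x‖ ≤ C) ∧
    ∀ ε : ℝ, 0 < ε → IsRelativelyDense {t : E | ∀ x, ‖f (x - t) - f x‖ < ε}

/-- Bounded functions. -/
def IsBddFun (f : E → ℂ) : Prop := ∃ C : ℝ, ∀ x, ‖f x‖ ≤ C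

lemma isometry_const_sub (x : E) : Isometry (fun y : E => x - y) :=
  Isometry.of_dist_eq (fun a b => dist_sub_left x a b)

lemma hasTemperateGrowth_const_sub (x : E) :
    Function.HasTemperateGrowth (fun y : E => x - y) := by
  apply Function.HasTemperateGrowth.of_fderiv (k := 1) (C := ‖x‖ + 1)
  · have h : (fderiv ℝ (fun y : E => x - y)) =
        fun _ : E => ((0 : E →L[ℝ] E) - ContinuousLinearMap.id ℝ E) := by
      funext y
      exact ((hasFDerivAt_const x y).sub (hasFDerivAt_id y)).fderiv
    rw [h]
    exact Function.HasTemperateGrowth.const _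
  · exact (differentiable_const x).sub differentiable_id
  · intro y
    have h1 : ‖x - y‖ ≤ ‖x‖ + ‖y‖ := norm_sub_le x y
    have h2 : (0:ℝ) ≤ ‖x‖ := norm_nonneg x
    have h3 : (0:ℝ) ≤ ‖y‖ := norm_nonneg y
    calc ‖x - y‖ ≤ ‖x‖ + ‖y‖ := h1
      _ ≤ (‖x‖ + 1) * (1 + ‖y‖) ^ 1 := by nlinarith

/-- The reflected translate `y ↦ ψ (x - y)` of a Schwartz function. -/
def transRefl (x : E) (ψ : SchwartzMap E ℂ) : SchwartzMap E ℂ :=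
  SchwartzMap.compCLMOfAntilipschitz (K := 1) ℝ (hasTemperateGrowth_const_sub x)
    (isometry_const_sub x).antilipschitz ψ

@[simp] lemma transRefl_apply (x : E) (ψ : SchwartzMap E ℂ) (y : E) :
    transRefl x ψ y = ψ (x - y) := rfl

/-- Convolution of a tempered distribution with a Schwartz function:
`(T * ψ)(x) = T (ψ (x - ·))`. -/
def convTD (T : SchwartzMap E ℂ →L[ℂ] ℂ) (ψ : SchwartzMap E ℂ) : E → ℂ :=
  fun x => T (transRefl x ψ)

/-- Smooth compactly supported test function, regarded inside the Schwartz space. -/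
def IsTestFn (φ : SchwartzMap E ℂ) : Prop := HasCompactSupport ⇑φ

/-- Translation bounded as a tempered distribution. -/
def TransBddTD (T : SchwartzMap E ℂ →L[ℂ] ℂ) : Prop :=
  ∀ ψ : SchwartzMap E ℂ, IsBddFun (convTD T ψ)

/-- Translation bounded as a distribution. -/
def TransBddD (T : SchwartzMap E ℂ →L[ℂ] ℂ) : Prop :=
  ∀ ψ : SchwartzMap E ℂ, IsTestFn ψ → IsBddFun (convTD T ψ)

/-- Strongly almost periodic as a tempered distribution. -/
def SAPTD (T : SchwartzMap E ℂ →L[ℂ] ℂ) : Prop :=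
  ∀ ψ : SchwartzMap E ℂ, IsBohrAP (convTD T ψ)

/-- Strongly almost periodic as a distribution. -/
def SAPD (T : SchwartzMap E ℂ →L[ℂ] ℂ) : Prop :=
  ∀ ψ : SchwartzMap E ℂ, IsTestFn ψ → IsBohrAP (convTD T ψ)

/-- The distributional Fourier transform, `T̂(φ) = T(φ̂)`, with the convention
`φ̂(ξ) = ∫ e^{-2πi⟨x,ξ⟩} φ(x) dx`. -/
def fourierTD (T : SchwartzMap E ℂ →L[ℂ] ℂ) : SchwartzMap E ℂ →L[ℂ] ℂ :=
  T.comp (SchwartzMap.fourierTransformCLM ℂ)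

/-- A complex Radon measure, encoded by its total variation measure together with a
unimodular density (polar decomposition). -/
structure CMeasure (E : Type*) [TopologicalSpace E] [MeasurableSpace E] where
  /-- the total variation measure -/
  tv : Measure E
  locFin : IsLocallyFiniteMeasure tv
  /-- the unimodular density -/
  density : E → ℂ
  density_meas : Measurable density
  density_norm : ∀ᵐ x ∂tv, ‖density x‖ = 1

namespace CMeasure

/-- Pairing of a complex measure with a function: `μ(φ) = ∫ φ dμ`. -/
def pairing (μ : CMeasure E) (φ : E → ℂ) : ℂ := ∫ x, φ x * μ.density x ∂μ.tv

/-- The complex measure agrees with the tempered distribution `T` on all smooth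
compactly supported test functions; i.e. `μ` is a tempered measure identified with `T`. -/
def Agrees (μ : CMeasure E) (T : SchwartzMap E ℂ →L[ℂ] ℂ) : Prop :=
  ∀ φ : SchwartzMap E ℂ, IsTestFn φ → T φ = μ.pairing ⇑φ

/-- A tempered measure is one that extends to a tempered distribution. -/
def IsTempered (μ : CMeasure E) : Prop := ∃ T, μ.Agrees T

/-- Pure point measure: concentrated on a countable set. -/
def IsPurePoint (μ : CMeasure E) : Prop := ∃ S : Set E, S.Countable ∧ μ.tv Sᶜ = 0

/-- Convolution of a complex measure with a function: `(μ * φ)(x) = ∫ φ(x - y) dμ(y)`. -/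
def convM (μ : CMeasure E) (φ : E → ℂ) : E → ℂ :=
  fun x => ∫ y, φ (x - y) * μ.density y ∂μ.tv

/-- Translation bounded as a measure. -/
def TransBddM (μ : CMeasure E) : Prop :=
  ∀ φ : E → ℂ, Continuous φ → HasCompactSupport φ → IsBddFun (μ.convM φ)

/-- Strongly almost periodic as a measure. -/
def SAPM (μ : CMeasure E) : Prop :=
  ∀ φ : E → ℂ, Continuous φ → HasCompactSupport φ → IsBohrAP (μ.convM φ)

/-- Strongly tempered measure: the total variation has polynomial growth,
equivalently `|μ|` is a tempered (slowly increasing) measure. -/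
def IsStronglyTempered (μ : CMeasure E) : Prop :=
  ∃ C a : ℝ, ∀ r : ℝ, 1 ≤ r → μ.tv (Metric.closedBall 0 r) ≤ ENNReal.ofReal (C * r ^ a)

/-- The atom of a complex measure at a point: `μ({x})`. -/
def atom (μ : CMeasure E) (x : E) : ℂ := (μ.tv {x}).toReal • μ.density x

/-- The measure is concentrated on a locally finite set. -/
def LocallyFiniteSupport (μ : CMeasure E) : Prop :=
  ∃ S : Set E, (∀ K : Set E, IsCompact K → (S ∩ K).Finite) ∧ μ.tv Sᶜ = 0

end CMeasure

end Preamble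

section Helpers

variable {E : Type*} [NormedAddCommGroup E] [InnerProductSpace ℝ E] [FiniteDimensional ℝ E]
  [MeasurableSpace E] [BorelSpace E]

open scoped ContDiff FourierTransform

lemma hh_cutoff_bound (b : ContDiffBump (0 : E)) (i : ℕ) :
    ∃ M : ℝ, 0 ≤ M ∧ ∀ (n : ℕ) (x : E),
      ‖iteratedFDeriv ℝ i (fun y : E => (((1 - b (((n : ℝ) + 1)⁻¹ • y) : ℝ)) : ℂ)) x‖ ≤ M := by
  have hsm : ContDiff ℝ ∞ (fun y : E => ((b y : ℝ) : ℂ)) :=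
    Complex.ofRealCLM.contDiff.comp b.contDiff
  have hcs : HasCompactSupport (fun y : E => ((b y : ℝ) : ℂ)) :=
    b.hasCompactSupport.comp_left (g := fun r : ℝ => (r : ℂ)) rfl
  have hsm1 : ContDiff ℝ ∞ (fun y : E => (((1 - b y : ℝ)) : ℂ)) :=
    Complex.ofRealCLM.contDiff.comp (contDiff_const.sub b.contDiff)
  obtain ⟨M, hM⟩ : ∃ M : ℝ, ∀ x, ‖iteratedFDeriv ℝ i (fun y : E => (((1 - b y : ℝ)) : ℂ)) x‖ ≤ M := by
    have hc : Continuous (iteratedFDeriv ℝ i (fun y : E => ((b y : ℝ) : ℂ))) :=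
      hsm.continuous_iteratedFDeriv (by exact_mod_cast le_top)
    obtain ⟨C, hC⟩ := (hcs.iteratedFDeriv (𝕜 := ℝ) i).exists_bound_of_continuous hc
    refine ⟨1 + C, fun x => ?_⟩
    have e : (fun y : E => (((1 - b y : ℝ)) : ℂ)) = (fun _ : E => (1 : ℂ)) - (fun y : E => ((b y : ℝ) : ℂ)) := by
      funext y; simp
    rw [e, iteratedFDeriv_sub_apply contDiffAt_const
      ((hsm.of_le (by exact_mod_cast le_top)).contDiffAt)]
    refine (norm_sub_le _ _).trans (add_le_add ?_ (hC x))
    rcases Nat.eq_zero_or_pos i with rfl | hi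
    · simp
    · rw [iteratedFDeriv_const_of_ne hi.ne']; simp
  refine ⟨M, (norm_nonneg _).trans (hM 0), fun n x => ?_⟩
  have := iteratedFDeriv_comp_const_smul (i := i) (((n : ℝ) + 1)⁻¹)
    (hsm1.of_le (by exact_mod_cast le_top))
  rw [show (fun y : E => (((1 - b (((n : ℝ) + 1)⁻¹ • y) : ℝ)) : ℂ)) =
    (fun y => (fun y : E => (((1 - b y : ℝ)) : ℂ)) (((n : ℝ) + 1)⁻¹ • y)) from rfl, this]
  simp only [norm_smul]
  have h0 : ‖(((n : ℝ) + 1)⁻¹) ^ i‖ ≤ 1 := by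
    rw [norm_pow, Real.norm_of_nonneg (by positivity)]
    apply pow_le_one₀ (by positivity)
    apply inv_le_one_of_one_le₀
    linarith [n.cast_nonneg (α := ℝ)]
  calc _ ≤ 1 * M := by gcongr; exact hM _
    _ = M := one_mul M

lemma hh_cutoff (f : SchwartzMap E ℂ) :
    ∃ (c : ℕ → E → ℝ) (F : ℕ → SchwartzMap E ℂ),
      (∀ n, IsTestFn (F n)) ∧ (∀ n x, F n x = (c n x : ℂ) * f x) ∧
      (∀ n x, 0 ≤ c n x) ∧ (∀ n x, c n x ≤ 1) ∧ (∀ (n : ℕ) x, ‖x‖ ≤ n → c n x = 1) ∧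
      Tendsto F atTop (𝓝 f) := by
  let b : ContDiffBump (0 : E) := ⟨1, 2, one_pos, one_lt_two⟩
  let c : ℕ → E → ℝ := fun n y => b (((n : ℝ) + 1)⁻¹ • y)
  have hcsm : ∀ n, ContDiff ℝ ∞ (c n) := fun n => b.contDiff.comp (contDiff_const_smul _)
  have hsm : ∀ n, ContDiff ℝ ∞ (fun y => (c n y : ℂ) * f y) := fun n =>
    (Complex.ofRealCLM.contDiff.comp (hcsm n)).mul (f.smooth ⊤)
  have hcs : ∀ n, HasCompactSupport (fun y => (c n y : ℂ) * f y) := by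
    intro n
    have h1 : HasCompactSupport (c n) := by
      have : (((n : ℝ) + 1)⁻¹) ≠ 0 := by positivity
      exact b.hasCompactSupport.comp_smul this
    exact (h1.comp_left (g := fun r : ℝ => (r : ℂ)) rfl).mul_right
  refine ⟨c, fun n => (hcs n).toSchwartzMap (hsm n), fun n => hcs n, fun n x => rfl,
    fun n x => b.nonneg, fun n x => b.le_one, ?_, ?_⟩
  · intro n x hx
    apply b.one_of_mem_closedBall
    simp only [mem_closedBall, dist_zero_right, norm_smul]
    change _ ≤ (1 : ℝ)
    rw [Real.norm_of_nonneg (by positivity), inv_mul_le_iff₀ (by positivity)]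
    linarith
  · rw [(schwartz_withSeminorms ℝ E ℂ).tendsto_nhds]
    rintro ⟨k, l⟩ ε hε
    choose M hM0 hM using hh_cutoff_bound b
    set K : ℝ := ∑ i ∈ Finset.range (l + 1),
      (l.choose i : ℝ) * M i * SchwartzMap.seminorm ℝ (k + 1) (l - i) f with hK
    have hK0 : 0 ≤ K := Finset.sum_nonneg fun i _ =>
      mul_nonneg (mul_nonneg (Nat.cast_nonneg _) (hM0 i)) (apply_nonneg _ _)
    have hlim : Tendsto (fun n : ℕ => K / ((n : ℝ) + 1)) atTop (𝓝 0) :=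
      tendsto_const_nhds.div_atTop (tendsto_atTop_add_const_right _ _ tendsto_natCast_atTop_atTop)
    filter_upwards [hlim.eventually (gt_mem_nhds hε)] with n hn
    refine lt_of_le_of_lt ?_ hn
    rw [SchwartzMap.schwartzSeminormFamily_apply]
    apply SchwartzMap.seminorm_le_bound ℝ k l _ (by positivity)
    intro x
    rw [← norm_neg (iteratedFDeriv _ _ _ _), ← iteratedFDeriv_neg_apply]
    have e : (-⇑((hcs n).toSchwartzMap (hsm n) - f)) =
        fun y => (((1 - b (((n : ℝ) + 1)⁻¹ • y) : ℝ)) : ℂ) * f y := by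
      funext y
      simp [c]
      ring
    rw [e]
    by_cases hx : ‖x‖ < (n : ℝ) + 1
    · have hz : (fun y => (((1 - b (((n : ℝ) + 1)⁻¹ • y) : ℝ)) : ℂ) * f y) =ᶠ[𝓝 x] fun _ => 0 := by
        have : {y : E | ‖y‖ < (n : ℝ) + 1} ∈ 𝓝 x := (isOpen_lt continuous_norm continuous_const).mem_nhds hx
        filter_upwards [this] with y hy
        have : b (((n : ℝ) + 1)⁻¹ • y) = 1 := by
          apply b.one_of_mem_closedBall
          simp only [mem_closedBall, dist_zero_right, norm_smul]
          change _ ≤ (1 : ℝ)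
          rw [Real.norm_of_nonneg (by positivity), inv_mul_le_iff₀ (by positivity)]
          have : ‖y‖ < (n : ℝ) + 1 := hy
          linarith
        rw [this]; simp
      rw [(Filter.EventuallyEq.iteratedFDeriv ℝ hz l).eq_of_nhds]
      have : iteratedFDeriv ℝ l (fun _ : E => (0 : ℂ)) x = 0 := by
        simp
      rw [this]
      simp only [norm_zero, mul_zero]
      positivity
    · push Not at hx
      have h1 := norm_iteratedFDeriv_mul_le (𝕜 := ℝ) (n := l) (N := ∞)
        (f := fun y : E => (((1 - b (((n : ℝ) + 1)⁻¹ • y) : ℝ)) : ℂ)) (g := f)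
        (Complex.ofRealCLM.contDiff.comp (contDiff_const.sub (hcsm n))) (f.smooth ⊤) x
        (by exact_mod_cast le_top)
      rw [le_div_iff₀ (by positivity)]
      calc _ ≤ ‖x‖ ^ k * (∑ i ∈ Finset.range (l + 1), (l.choose i : ℝ) *
              ‖iteratedFDeriv ℝ i (fun y : E => (((1 - b (((n : ℝ) + 1)⁻¹ • y) : ℝ)) : ℂ)) x‖ *
                ‖iteratedFDeriv ℝ (l - i) f x‖) * ‖x‖ := by gcongr
        _ = ∑ i ∈ Finset.range (l + 1), (l.choose i : ℝ) *
              ‖iteratedFDeriv ℝ i (fun y : E => (((1 - b (((n : ℝ) + 1)⁻¹ • y) : ℝ)) : ℂ)) x‖ *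
                (‖x‖ ^ (k + 1) * ‖iteratedFDeriv ℝ (l - i) f x‖) := by
            rw [Finset.mul_sum, Finset.sum_mul]
            refine Finset.sum_congr rfl fun i _ => ?_
            ring
        _ ≤ K := by
            refine Finset.sum_le_sum fun i _ => ?_
            have := hM i n x
            have := hM0 i
            gcongr
            exact SchwartzMap.le_seminorm ℝ (k + 1) (l - i) f x

lemma hh_upper (μ : CMeasure E) (T : SchwartzMap E ℂ →L[ℂ] ℂ) (hμT : μ.Agrees T)
    (f : SchwartzMap E ℂ) : ‖T f‖ₑ ≤ ∫⁻ x, ‖f x‖ₑ ∂μ.tv := by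
  obtain ⟨c, F, hF, hFc, h0, h1, -, hlim⟩ := hh_cutoff f
  have hT : Tendsto (fun n => ‖T (F n)‖ₑ) atTop (𝓝 ‖T f‖ₑ) :=
    ((T.continuous.tendsto f).comp hlim).enorm
  refine le_of_tendsto' hT fun n => ?_
  rw [hμT _ (hF n)]
  refine (enorm_integral_le_lintegral_enorm _).trans (lintegral_mono_ae ?_)
  filter_upwards [μ.density_norm] with x hx
  rw [← ofReal_norm, ← ofReal_norm]
  apply ENNReal.ofReal_le_ofReal
  rw [norm_mul, hx, mul_one, hFc, norm_mul, Complex.norm_real, Real.norm_of_nonneg (h0 n x)]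
  exact mul_le_of_le_one_left (norm_nonneg _) (h1 n x)

lemma hh_lower (μ : CMeasure E) (T : SchwartzMap E ℂ →L[ℂ] ℂ) (hμT : μ.Agrees T)
    (hpos : ∀ᵐ x ∂μ.tv, μ.density x = 1)
    (f : SchwartzMap E ℂ) (g : E → ℝ) (hfg : ∀ x, f x = (g x : ℂ)) (hg : ∀ x, 0 ≤ g x)
    (a r : ℝ) (z : E) (hb : ∀ x ∈ ball z r, a ≤ g x) :
    ENNReal.ofReal a * μ.tv (ball z r) ≤ ‖T f‖ₑ := by
  obtain ⟨c, F, hF, hFc, h0, h1, hc1, hlim⟩ := hh_cutoff f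
  have hT : Tendsto (fun n => ‖T (F n)‖ₑ) atTop (𝓝 ‖T f‖ₑ) :=
    ((T.continuous.tendsto f).comp hlim).enorm
  refine ge_of_tendsto hT ?_
  obtain ⟨N, hN⟩ := exists_nat_ge (‖z‖ + r)
  filter_upwards [eventually_ge_atTop N] with n hn
  have := μ.locFin
  have hFr : ∀ x, F n x = ((c n x * g x : ℝ) : ℂ) := by
    intro x; rw [hFc, hfg]; push_cast; rfl
  have hre : (fun x => c n x * g x) = fun x => (F n x).re := by
    funext x; rw [hFr, Complex.ofReal_re]
  have hint : Integrable (fun x => F n x) μ.tv :=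
    (F n).continuous.integrable_of_hasCompactSupport (hF n)
  have hTn : T (F n) = ((∫ x, c n x * g x ∂μ.tv : ℝ) : ℂ) := by
    rw [hμT _ (hF n), CMeasure.pairing, ← integral_complex_ofReal]
    apply integral_congr_ae
    filter_upwards [hpos] with x hx
    rw [hx, mul_one, hFr]
  have hintr : Integrable (fun x => c n x * g x) μ.tv := by
    rw [hre]; exact hint.re
  have hnn : ∀ x, 0 ≤ c n x * g x := fun x => mul_nonneg (h0 n x) (hg x)
  rw [hTn, ← ofReal_norm, Complex.norm_real, Real.norm_of_nonneg (integral_nonneg hnn),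
    ofReal_integral_eq_lintegral_ofReal hintr (Eventually.of_forall hnn)]
  rw [← setLIntegral_const]
  refine le_trans (setLIntegral_mono' measurableSet_ball fun x hx => ?_) (setLIntegral_le_lintegral (ball z r) _)
  apply ENNReal.ofReal_le_ofReal
  rw [hc1 n x, one_mul]
  · exact hb x hx
  · have h2 : ‖x - z‖ < r := by simpa [dist_eq_norm] using hx
    have h3 : ‖x‖ ≤ ‖x - z‖ + ‖z‖ := by simpa using norm_add_le (x - z) z
    have h4 : (N : ℝ) ≤ n := by exact_mod_cast hn
    linarith

lemma hh_window : ∃ (h : SchwartzMap E ℂ) (g : E → ℝ) (a r : ℝ), IsTestFn h ∧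
    (∀ x, 𝓕 h x = (g x : ℂ)) ∧ (∀ x, 0 ≤ g x) ∧ 0 < a ∧ 0 < r ∧ ∀ x ∈ ball (0 : E) r, a ≤ g x := by
  let b : ContDiffBump (0 : E) := ⟨1, 2, one_pos, one_lt_two⟩
  have hsm : ContDiff ℝ ∞ (fun y : E => ((b y : ℝ) : ℂ)) :=
    Complex.ofRealCLM.contDiff.comp b.contDiff
  have hcs : HasCompactSupport (fun y : E => ((b y : ℝ) : ℂ)) :=
    b.hasCompactSupport.comp_left (g := fun r : ℝ => (r : ℂ)) rfl
  let s : SchwartzMap E ℂ := hcs.toSchwartzMap hsm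
  have hsv : ∀ y, s y = ((b y : ℝ) : ℂ) := fun y => rfl
  let h := SchwartzMap.convolution (ContinuousLinearMap.mul ℂ ℂ) s s
  have hreal : ∀ x, conj (𝓕 s x) = 𝓕 s x := by
    intro x
    rw [SchwartzMap.fourier_coe, Real.fourier_eq', ← integral_conj, ← integral_neg_eq_self]
    congr 1
    funext v
    simp only [hsv, smul_eq_mul, map_mul, ← Complex.exp_conj, Complex.conj_ofReal, Complex.conj_I,
      inner_neg_left, b.neg]
    congr 2
    push_cast
    ring
  have hre : ∀ x, 𝓕 s x = (((𝓕 s x).re : ℝ) : ℂ) := fun x =>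
    (Complex.conj_eq_iff_re.mp (hreal x)).symm
  have hF : ∀ x, 𝓕 h x = (((𝓕 s x).re ^ 2 : ℝ) : ℂ) := by
    intro x
    simp only [h]
    rw [SchwartzMap.fourier_convolution, SchwartzMap.pairing_apply_apply]
    simp only [ContinuousLinearMap.mul_apply']
    rw [hre x]; push_cast; simp [sq]
  have h0 : 0 < (𝓕 s 0).re := by
    rw [SchwartzMap.fourier_coe, Real.fourier_eq']
    simp only [inner_zero_right, mul_zero, Complex.ofReal_zero, zero_mul, Complex.exp_zero, one_smul]
    have : ∫ v, s v = ((∫ v, b v : ℝ) : ℂ) := by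
      rw [← integral_complex_ofReal]; rfl
    rw [this, Complex.ofReal_re]
    exact b.integral_pos
  have hcont : Continuous fun x => (𝓕 s x).re ^ 2 := by
    have := (𝓕 s).continuous
    fun_prop
  have hev : ∀ᶠ x in 𝓝 (0 : E), (𝓕 s 0).re ^ 2 / 2 < (𝓕 s x).re ^ 2 :=
    (hcont.tendsto 0).eventually (lt_mem_nhds (by have := pow_pos h0 2; linarith))
  obtain ⟨r, hr, hball⟩ := Metric.eventually_nhds_iff_ball.mp hev
  refine ⟨h, fun x => (𝓕 s x).re ^ 2, (𝓕 s 0).re ^ 2 / 2, r, ?_, hF, fun x => sq_nonneg _,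
    by positivity, hr, fun x hx => (hball x hx).le⟩
  have : (⇑h : E → ℂ) = MeasureTheory.convolution s s (ContinuousLinearMap.mul ℂ ℂ) volume := by
    funext x; exact SchwartzMap.convolution_apply _ _ _ _
  rw [IsTestFn, this]
  exact HasCompactSupport.convolution _ hcs hcs

lemma hh_modulate (h : SchwartzMap E ℂ) (hh : IsTestFn h) (z : E) :
    ∃ H : SchwartzMap E ℂ, IsTestFn H ∧ (∀ x, ‖H x‖ = ‖h x‖) ∧ ∀ y, 𝓕 H y = 𝓕 h (y - z) := by
  have hsm : ContDiff ℝ ∞ (fun v : E =>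
      Complex.exp (((2 * Real.pi * inner ℝ v z : ℝ) : ℂ) * I) * h v) := by
    have h1 : ContDiff ℝ ∞ (fun v : E => ((2 * Real.pi * inner ℝ v z : ℝ) : ℂ)) :=
      Complex.ofRealCLM.contDiff.comp
        (f := fun v : E => 2 * Real.pi * inner ℝ v z) (contDiff_const.mul (contDiff_id.inner ℝ contDiff_const))
    exact ((h1.mul contDiff_const).cexp).mul (h.smooth ⊤)
  have hcs : HasCompactSupport (fun v : E =>
      Complex.exp (((2 * Real.pi * inner ℝ v z : ℝ) : ℂ) * I) * h v) := HasCompactSupport.mul_left hh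
  refine ⟨hcs.toSchwartzMap hsm, hcs, fun x => ?_, fun y => ?_⟩
  · simp only [HasCompactSupport.toSchwartzMap_toFun, norm_mul, Complex.norm_exp_ofReal_mul_I, one_mul]
  · rw [SchwartzMap.fourier_coe, SchwartzMap.fourier_coe, Real.fourier_eq', Real.fourier_eq']
    congr 1
    funext v
    simp only [HasCompactSupport.toSchwartzMap_toFun, smul_eq_mul]
    rw [← mul_assoc, ← Complex.exp_add]
    congr 2
    rw [inner_sub_right]
    push_cast
    ring

lemma hh_ball (μ : CMeasure E) (T : SchwartzMap E ℂ →L[ℂ] ℂ) (hμT : μ.Agrees T)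
    (hpos : ∀ᵐ x ∂μ.tv, μ.density x = 1) (ν : CMeasure E) (hν : ν.Agrees (fourierTD T)) :
    ∃ (r : ℝ) (C : ℝ≥0), 0 < r ∧ ∀ z : E, μ.tv (ball z r) ≤ C := by
  obtain ⟨h, g, a, r, hh, hF, hg, ha, hr, hb⟩ := hh_window (E := E)
  have := ν.locFin
  have hfin : ∫⁻ x, ‖h x‖ₑ ∂ν.tv ≠ ⊤ :=
    (h.continuous.integrable_of_hasCompactSupport hh (μ := ν.tv)).2.ne
  have ha' : ENNReal.ofReal a ≠ 0 := by simpa using ha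
  refine ⟨r, ((∫⁻ x, ‖h x‖ₑ ∂ν.tv) / ENNReal.ofReal a).toNNReal, hr, fun z => ?_⟩
  rw [ENNReal.coe_toNNReal (ENNReal.div_ne_top hfin ha'),
    ENNReal.le_div_iff_mul_le (Or.inl ha') (Or.inl ENNReal.ofReal_ne_top), mul_comm]
  obtain ⟨H, hHt, hHn, hHF⟩ := hh_modulate h hh z
  refine (hh_lower μ T hμT hpos (𝓕 H) (fun y => g (y - z)) (fun y => by rw [hHF, hF])
    (fun y => hg _) a r z (fun x hx => hb _ ?_)).trans ?_
  · simpa [dist_eq_norm] using hx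
  · have e : T (𝓕 H) = fourierTD T H := rfl
    rw [e, hν H hHt]
    refine (enorm_integral_le_lintegral_enorm _).trans (lintegral_mono_ae ?_)
    filter_upwards [ν.density_norm] with x hx
    rw [← ofReal_norm, ← ofReal_norm, norm_mul, hx, mul_one, hHn]

lemma hh_transBddM (μ : CMeasure E) (r : ℝ) (C : ℝ≥0) (hr : 0 < r)
    (hC : ∀ z : E, μ.tv (ball z r) ≤ C) : μ.TransBddM := by
  intro φ hφ hcs
  obtain ⟨B, hB⟩ := hcs.exists_bound_of_continuous hφ
  have hB0 : 0 ≤ B := (norm_nonneg _).trans (hB 0)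
  obtain ⟨t, -, ht⟩ := hcs.isCompact.elim_finite_subcover_image (b := Set.univ)
    (c := fun z : E => ball z r) (fun _ _ => isOpen_ball)
    (fun x _ => Set.mem_biUnion (Set.mem_univ x) (mem_ball_self hr))
  obtain ⟨htf, ht⟩ := ht
  let S := htf.toFinset
  refine ⟨(ENNReal.ofReal B * (S.card * C)).toReal, fun x => ?_⟩
  rw [← toReal_enorm]
  apply ENNReal.toReal_mono (by finiteness)
  refine (enorm_integral_le_lintegral_enorm _).trans ?_
  calc _ ≤ ∫⁻ y, (⋃ z ∈ S, ball (x - z) r).indicator (fun _ => ENNReal.ofReal B) y ∂μ.tv := by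
        refine lintegral_mono_ae ?_
        filter_upwards [μ.density_norm] with y hy
        rw [← ofReal_norm, norm_mul, hy, mul_one]
        by_cases h : y ∈ ⋃ z ∈ S, ball (x - z) r
        · rw [Set.indicator_of_mem h]
          exact ENNReal.ofReal_le_ofReal (hB _)
        · have : φ (x - y) = 0 := by
            by_contra hne
            have h1 := ht (subset_tsupport _ (Function.mem_support.mpr hne))
            apply h
            simp only [Set.mem_iUnion, mem_ball, dist_eq_norm, exists_prop] at h1 ⊢
            obtain ⟨z, hz, hz2⟩ := h1
            refine ⟨z, by simpa [S] using hz, ?_⟩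
            rw [← norm_neg]
            rwa [show -(y - (x - z)) = x - y - z by abel]
          simp [this]
    _ = ENNReal.ofReal B * μ.tv (⋃ z ∈ S, ball (x - z) r) := by
        rw [lintegral_indicator_const]
        exact S.measurableSet_biUnion fun _ _ => measurableSet_ball
    _ ≤ ENNReal.ofReal B * (S.card * C) := by
        gcongr
        refine (measure_biUnion_finset_le _ _).trans ?_
        refine (Finset.sum_le_sum fun z _ => hC (x - z)).trans ?_
        simp

lemma hh_finite (m : Measure E) [IsLocallyFiniteMeasure m] (r : ℝ) (C : ℝ≥0) (hr : 0 < r)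
    (hC : ∀ z : E, m (ball z r) ≤ C) (f : SchwartzMap E ℂ) : ∫⁻ x, ‖f x‖ₑ ∂m ≠ ⊤ := by
  let p : ℕ := Module.finrank ℝ E + 1
  let w : E → ℝ := fun x => (1 + ‖x‖) ^ (-(p : ℝ))
  have hwm : Measurable fun x => ENNReal.ofReal (w x) := by
    simp only [w]; fun_prop
  have hw0 : ∀ x, 0 < w x := fun x => by simp only [w]; positivity
  have hwfin : ∫⁻ x : E, ENNReal.ofReal (w x) < ⊤ :=
    finite_integral_one_add_norm (by simp [p])
  obtain ⟨A, hA⟩ : ∃ A : ℝ, ∀ x, ‖f x‖ ≤ A * w x := by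
    refine ⟨2 ^ p * (Finset.Iic (p, 0)).sup
      (fun m : ℕ × ℕ => SchwartzMap.seminorm ℝ m.1 m.2) f, fun x => ?_⟩
    have := SchwartzMap.one_add_le_sup_seminorm_apply (𝕜 := ℝ) (m := (p, 0)) le_rfl le_rfl f x
    simp only [norm_iteratedFDeriv_zero] at this
    simp only [w]
    rw [Real.rpow_neg (by positivity), Real.rpow_natCast, ← div_eq_mul_inv,
      le_div_iff₀ (by positivity), mul_comm]
    exact this
  have hwcomp : ∀ x y : E, dist x y < r → w x ≤ (1 + r) ^ p * w y := by
    intro x y hxy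
    simp only [w]
    rw [Real.rpow_neg (by positivity), Real.rpow_natCast, Real.rpow_neg (by positivity),
      Real.rpow_natCast, ← div_eq_mul_inv, le_div_iff₀ (by positivity), inv_mul_le_iff₀ (by positivity),
      ← mul_pow]
    gcongr
    have : ‖y‖ ≤ ‖x‖ + r := by
      have h3 : ‖y‖ ≤ ‖y - x‖ + ‖x‖ := by simpa using norm_add_le (y - x) x
      rw [dist_comm, dist_eq_norm] at hxy
      linarith
    nlinarith [norm_nonneg x]
  have hv0 : volume (ball (0 : E) r) ≠ 0 := (measure_ball_pos _ _ hr).ne'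
  have hvt : volume (ball (0 : E) r) ≠ ⊤ := measure_ball_lt_top.ne
  have key : volume (ball (0 : E) r) * ∫⁻ x, ENNReal.ofReal (w x) ∂m ≤
      ENNReal.ofReal ((1 + r) ^ p) * (C * ∫⁻ y : E, ENNReal.ofReal (w y)) := by
    have hset : MeasurableSet {q : E × E | dist q.1 q.2 < r} :=
      (isOpen_lt continuous_dist continuous_const).measurableSet
    let K : ℝ := (1 + r) ^ p
    have hK : 0 ≤ K := by positivity
    let D : Set (E × E) := {q : E × E | dist q.1 q.2 < r}
    calc volume (ball (0 : E) r) * ∫⁻ x, ENNReal.ofReal (w x) ∂m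
          = ∫⁻ x, (∫⁻ y, D.indicator (fun q => ENNReal.ofReal (w q.1)) (x, y)) ∂m := by
            rw [← lintegral_const_mul _ hwm]
            refine lintegral_congr fun x => ?_
            have e : (fun y => D.indicator (fun q => ENNReal.ofReal (w q.1)) (x, y)) =
                (ball x r).indicator (fun _ => ENNReal.ofReal (w x)) := by
              funext y
              by_cases h : dist x y < r
              · rw [Set.indicator_of_mem (show (x, y) ∈ D from h),
                  Set.indicator_of_mem (by rwa [mem_ball, dist_comm])]
              · rw [Set.indicator_of_notMem (show (x, y) ∉ D from h),
                  Set.indicator_of_notMem (by rwa [mem_ball, dist_comm])]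
            rw [e, lintegral_indicator_const measurableSet_ball, Measure.addHaar_ball_center _ x, mul_comm]
      _ ≤ ∫⁻ x, (∫⁻ y, D.indicator (fun q => ENNReal.ofReal (K * w q.2)) (x, y)) ∂m := by
            refine lintegral_mono fun x => lintegral_mono fun y => ?_
            refine Set.indicator_le_indicator' fun h => ?_
            exact ENNReal.ofReal_le_ofReal (hwcomp x y h)
      _ = ∫⁻ y, ∫⁻ x, D.indicator (fun q => ENNReal.ofReal (K * w q.2)) (x, y) ∂m := by
            apply lintegral_lintegral_swap
              (f := fun x y => D.indicator (fun q => ENNReal.ofReal (K * w q.2)) (x, y))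
            apply Measurable.aemeasurable
            refine Measurable.indicator ?_ hset
            have : Measurable w := by simp only [w]; fun_prop
            fun_prop
      _ ≤ ∫⁻ y : E, ENNReal.ofReal K * (C * ENNReal.ofReal (w y)) := by
            refine lintegral_mono fun y => ?_
            have e : (fun x => D.indicator (fun q => ENNReal.ofReal (K * w q.2)) (x, y)) =
                (ball y r).indicator (fun _ => ENNReal.ofReal (K * w y)) := by
              funext x
              by_cases h : dist x y < r
              · rw [Set.indicator_of_mem (show (x, y) ∈ D from h),
                  Set.indicator_of_mem (by rwa [mem_ball])]
              · rw [Set.indicator_of_notMem (show (x, y) ∉ D from h),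
                  Set.indicator_of_notMem (by rwa [mem_ball])]
            simp only [e]
            rw [lintegral_indicator_const measurableSet_ball, ENNReal.ofReal_mul hK, mul_assoc,
              mul_comm (ENNReal.ofReal (w y))]
            gcongr
            exact hC y
      _ = _ := by
            rw [lintegral_const_mul _ (by fun_prop), lintegral_const_mul _ hwm]
  have hwm_fin : ∫⁻ x, ENNReal.ofReal (w x) ∂m ≠ ⊤ := by
    intro htop
    rw [htop, ENNReal.mul_top hv0] at key
    exact absurd (top_le_iff.mp key) (by finiteness)
  refine ne_top_of_le_ne_top (b := ENNReal.ofReal A * ∫⁻ x, ENNReal.ofReal (w x) ∂m)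
    (by finiteness) ?_
  rw [← lintegral_const_mul _ hwm]
  refine lintegral_mono fun x => ?_
  rw [← ofReal_norm, ← ENNReal.ofReal_mul' (hw0 x).le]
  exact ENNReal.ofReal_le_ofReal (hA x)

lemma hh_fourier_transRefl (x : E) (ψ : SchwartzMap E ℂ) (y : E) :
    ‖𝓕 (transRefl x ψ) y‖ = ‖𝓕 ψ (-y)‖ := by
  have e : 𝓕 (transRefl x ψ) y =
      Complex.exp (((-2 * Real.pi * inner ℝ x y : ℝ) : ℂ) * I) * 𝓕 ψ (-y) := by
    rw [SchwartzMap.fourier_coe, SchwartzMap.fourier_coe, Real.fourier_eq', Real.fourier_eq',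
      ← integral_const_mul, ← integral_sub_left_eq_self _ volume x]
    congr 1
    funext v
    simp only [transRefl_apply, smul_eq_mul, sub_sub_cancel]
    rw [← mul_assoc, ← Complex.exp_add]
    congr 2
    rw [inner_sub_left, inner_neg_right]
    push_cast
    ring
  rw [e, norm_mul, Complex.norm_exp_ofReal_mul_I, one_mul]

end Helpers

/-- A positive tempered measure on `ℝ^d` whose Fourier transform is a
measure is translation bounded as a measure, and its Fourier transform is translation
bounded as a tempered distribution. -/
theorem positive_transBdd (d : ℕ)
    (μ : CMeasure (EuclideanSpace ℝ (Fin d)))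
    (T : SchwartzMap (EuclideanSpace ℝ (Fin d)) ℂ →L[ℂ] ℂ)
    (hμT : μ.Agrees T)
    (hpos : ∀ᵐ x ∂μ.tv, μ.density x = 1)
    (ν : CMeasure (EuclideanSpace ℝ (Fin d)))
    (hν : ν.Agrees (fourierTD T)) :
    μ.TransBddM ∧ TransBddTD (fourierTD T) := by
  obtain ⟨r, C, hr, hC⟩ := hh_ball μ T hμT hpos ν hν
  refine ⟨hh_transBddM μ r C hr hC, fun ψ => ?_⟩
  have := μ.locFin
  have hfin := hh_finite μ.tv r C hr hC (transRefl 0 (SchwartzMap.fourierTransformCLM ℂ ψ))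
  refine ⟨(∫⁻ y, ‖transRefl 0 (SchwartzMap.fourierTransformCLM ℂ ψ) y‖ₑ ∂μ.tv).toReal, fun x => ?_⟩
  rw [← toReal_enorm]
  refine ENNReal.toReal_mono hfin ?_
  refine (hh_upper μ T hμT (SchwartzMap.fourierTransformCLM ℂ (transRefl x ψ))).trans
    (lintegral_mono fun y => ?_)
  rw [← ofReal_norm, ← ofReal_norm]
  apply ENNReal.ofReal_le_ofReal
  rw [transRefl_apply, zero_sub]
  exact (hh_fourier_transRefl x ψ y).le
end
end

section
/- There exists a crystalline measure μ on ℝ such that neither μ nor its distributional Fourier transform μ̂ is translation bounded as a tempered distribution. In particular, neither μ nor μ̂ is a strongly tempered measure. -/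
set_option linter.unusedSectionVars false

open MeasureTheory Filter Metric Complex SchwartzMap
open scoped Topology ENNReal NNReal ComplexConjugate

noncomputable section

/-- locally finite support of a weight. -/
def LFw (w : ℝ → ℂ) : Prop := ∀ R : ℝ, {x : ℝ | |x| ≤ R ∧ w x ≠ 0}.Finite

lemma LFw.add {w v : ℝ → ℂ} (hw : LFw w) (hv : LFw v) : LFw (fun x => w x + v x) := by
  intro R
  refine ((hw R).union (hv R)).subset ?_
  rintro x ⟨hx, h⟩
  by_cases h1 : w x = 0
  · right; refine ⟨hx, fun h2 => h (by simp [h1, h2])⟩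
  · left; exact ⟨hx, h1⟩

lemma LFw.countable {w : ℝ → ℂ} (hw : LFw w) : {x : ℝ | w x ≠ 0}.Countable := by
  have : {x : ℝ | w x ≠ 0} ⊆ ⋃ n : ℕ, {x : ℝ | |x| ≤ n ∧ w x ≠ 0} := by
    intro x hx
    obtain ⟨n, hn⟩ := exists_nat_ge |x|
    exact Set.mem_iUnion.2 ⟨n, hn, hx⟩
  exact (Set.countable_iUnion fun n : ℕ => (hw n).countable).mono this

def wtv (w : ℝ → ℂ) : Measure ℝ := Measure.sum (fun x : ℝ => ‖w x‖ₑ • Measure.dirac x)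

lemma wtv_apply (w : ℝ → ℂ) {s : Set ℝ} (hs : MeasurableSet s) :
    wtv w s = ∑' x : ℝ, ‖w x‖ₑ * s.indicator 1 x := by
  rw [wtv, Measure.sum_apply _ hs]
  congr 1; ext x
  simp [Measure.dirac_apply' x hs]

lemma wtv_ball_lt {w : ℝ → ℂ} (hw : LFw w) (R : ℝ) : wtv w (closedBall 0 R) < ∞ := by
  rw [wtv_apply w measurableSet_closedBall]
  rw [tsum_eq_sum (s := (hw R).toFinset)]
  · refine ENNReal.sum_lt_top.2 fun x _ => ENNReal.mul_lt_top (by simp) ?_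
    by_cases h : x ∈ closedBall (0:ℝ) R <;> simp [h]
  · intro x hx
    by_cases h : x ∈ closedBall (0:ℝ) R
    · simp at hx h
      simp [hx h]
    · simp [h]

lemma wtv_locFin {w : ℝ → ℂ} (hw : LFw w) : IsLocallyFiniteMeasure (wtv w) := by
  refine ⟨fun x => ⟨closedBall 0 (|x| + 1), ?_, wtv_ball_lt hw _⟩⟩
  refine mem_of_superset (Metric.ball_mem_nhds x one_pos) ?_
  intro y hy
  simp [Real.dist_eq] at hy ⊢
  have := abs_sub_abs_le_abs_sub y x
  linarith

def wden (w : ℝ → ℂ) (x : ℝ) : ℂ := open Classical in if w x = 0 then 1 else w x / ‖w x‖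

lemma wden_norm (w : ℝ → ℂ) (x : ℝ) : ‖wden w x‖ = 1 := by
  unfold wden; split_ifs with h <;> simp [h]

lemma wden_mul (w : ℝ → ℂ) (x : ℝ) : (‖w x‖ : ℂ) * wden w x = w x := by
  unfold wden; split_ifs with h
  · simp [h]
  · have : (‖w x‖ : ℂ) ≠ 0 := by simp [h]
    field_simp

def wM (w : ℝ → ℂ) (hw : LFw w) : CMeasure ℝ where
  tv := wtv w
  locFin := wtv_locFin hw
  density := wden w
  density_meas := by
    refine (measurable_const (a := (1:ℂ))).measurable_of_countable_ne (hw.countable.mono ?_)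
    intro x hx h
    exact hx (by simp [wden, h])
  density_norm := Eventually.of_forall (wden_norm w)

lemma wM_lf (w : ℝ → ℂ) (hw : LFw w) :
    (wM w hw).IsPurePoint ∧ (wM w hw).LocallyFiniteSupport := by
  have h0 : (wM w hw).tv {x : ℝ | w x ≠ 0}ᶜ = 0 := by
    change wtv w _ = 0
    rw [wtv_apply w hw.countable.measurableSet.compl]
    simp only [ENNReal.tsum_eq_zero]
    intro x
    by_cases h : w x = 0 <;> simp [h]
  refine ⟨⟨_, hw.countable, h0⟩, ⟨_, fun K hK => ?_, h0⟩⟩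
  obtain ⟨R, hR⟩ := hK.isBounded.subset_closedBall 0
  refine (hw R).subset fun x hx => ⟨?_, hx.1⟩
  simpa using hR hx.2

lemma wM_pairing (w : ℝ → ℂ) (hw : LFw w) (φ : SchwartzMap ℝ ℂ) (hφ : IsTestFn φ) :
    HasSum (fun x => w x * φ x) ((wM w hw).pairing φ) := by
  have : IsLocallyFiniteMeasure (wtv w) := wtv_locFin hw
  have hi : Integrable (fun x => φ x * wden w x) (wtv w) := by
    refine Integrable.mul_bdd (c := 1) (φ.continuous.integrable_of_hasCompactSupport hφ)
      (wM w hw).density_meas.aestronglyMeasurable (Eventually.of_forall fun x => (wden_norm w x).le)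
  have := hasSum_integral_measure hi
  have h2 : (fun x => w x * φ x) =
      fun i => ∫ x, φ x * wden w x ∂(‖w i‖ₑ • Measure.dirac i) := by
    ext x
    rw [integral_smul_measure, integral_dirac]
    simp only [toReal_enorm, Complex.real_smul]
    rw [mul_left_comm, wden_mul, mul_comm]
  rw [h2]
  exact this

lemma wM_not_strong (w : ℝ → ℂ) (hw : LFw w)
    (h : ∀ n : ℕ, Real.exp (((2 * n + 2 : ℕ) : ℝ) ^ 2 / 2) ≤ ‖w ((2 * n + 2 : ℕ) : ℝ)‖) :
    ¬ (wM w hw).IsStronglyTempered := by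
  rintro ⟨C, a, hC⟩
  have key : ∀ n : ℕ, Real.exp (((2 * n + 2 : ℕ) : ℝ) ^ 2 / 2) ≤
      |C| * ((2 * n + 2 : ℕ) : ℝ) ^ a := by
    intro n
    set r : ℝ := ((2 * n + 2 : ℕ) : ℝ) with hr
    have hr1 : 1 ≤ r := by rw [hr]; push_cast; linarith [(Nat.cast_nonneg n : (0:ℝ) ≤ n)]
    have h1 : ‖w r‖ₑ ≤ wtv w (closedBall 0 r) := by
      rw [wtv_apply w measurableSet_closedBall]
      refine le_trans ?_ (ENNReal.le_tsum r)
      have : r ∈ closedBall (0:ℝ) r := by simp [abs_of_nonneg (zero_le_one.trans hr1)]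
      simp [this]
    have h2 := h1.trans (hC r hr1)
    have h3 : ‖w r‖ ≤ |C * r ^ a| := by
      rw [← ofReal_norm] at h2
      have := (ENNReal.ofReal_le_ofReal_iff' ).1 h2
      rcases this with h | h
      · exact h.trans (le_abs_self _)
      · exact h.trans (abs_nonneg _)
    refine (h n).trans (h3.trans ?_)
    rw [abs_mul, abs_of_nonneg (Real.rpow_nonneg (zero_le_one.trans hr1) a)]
  have ht : Tendsto (fun n : ℕ => ((2 * n + 2 : ℕ) : ℝ)) atTop atTop := by
    refine tendsto_natCast_atTop_atTop.comp ?_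
    exact tendsto_atTop_mono (fun n => by simp only [id]; omega) tendsto_id
  have h4 := ((tendsto_rpow_mul_exp_neg_mul_atTop_nhds_zero a 1 one_pos).const_mul |C|).comp ht
  have h5 := (h4.eventually (gt_mem_nhds (show |C| * 0 < 1 by simp))).exists
  obtain ⟨n, hn⟩ := h5
  have h6 := key n
  simp only [Function.comp] at hn
  set r : ℝ := ((2 * n + 2 : ℕ) : ℝ) with hr
  have hr1 : 2 ≤ r := by rw [hr]; push_cast; linarith [(Nat.cast_nonneg n : (0:ℝ) ≤ n)]
  have h7 : Real.exp r ≤ Real.exp (r ^ 2 / 2) := Real.exp_le_exp.2 (by nlinarith)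
  have h8 : Real.exp r * Real.exp (-1 * r) = 1 := by rw [← Real.exp_add]; simp
  have h9 : 0 < Real.exp (-1 * r) := Real.exp_pos _
  have : Real.exp r * Real.exp (-1 * r) ≤ |C| * r ^ a * Real.exp (-1 * r) :=
    mul_le_mul_of_nonneg_right (h7.trans h6) h9.le
  nlinarith
/-- affine composition on Schwartz functions. -/
lemma exists_affC (a b : ℝ) (ha : a ≠ 0) (φ : SchwartzMap ℝ ℂ) :
    ∃ η : SchwartzMap ℝ ℂ, ∀ x, η x = φ (a * x + b) := by
  have h1 : Function.HasTemperateGrowth (fun x : ℝ => a * x + b) := by fun_prop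
  have h2 : AntilipschitzWith ‖a⁻¹‖₊ (fun x : ℝ => a * x + b) := by
    refine AntilipschitzWith.of_le_mul_dist fun x y => ?_
    simp only [Real.dist_eq, coe_nnnorm, Real.norm_eq_abs]
    rw [show a * x + b - (a * y + b) = a * (x - y) by ring, abs_mul, ← mul_assoc, ← abs_mul,
      inv_mul_cancel₀ ha]
    simp
  exact ⟨SchwartzMap.compCLMOfAntilipschitz ℂ h1 h2 φ, fun x => rfl⟩

lemma fourier_affine (a b : ℝ) (ha : a ≠ 0) (φ η : SchwartzMap ℝ ℂ)
    (h : ∀ x, η x = φ (a * x + b)) (ξ : ℝ) :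
    FourierTransform.fourier η ξ = (|a|⁻¹ : ℝ) * Complex.exp (2 * Real.pi * I * (b * ξ / a : ℝ)) *
      FourierTransform.fourier φ (ξ / a) := by
  simp only [SchwartzMap.fourier_coe, Real.fourier_real_eq_integral_exp_smul, smul_eq_mul]
  set Z : ℝ → ℂ := fun z : ℝ => Complex.exp (2 * Real.pi * I * (b * ξ / a : ℝ)) *
        (Complex.exp (((-2 * Real.pi * z * (ξ / a) : ℝ) : ℂ) * I) * φ z) with hZ
  have h1 : ∀ x : ℝ, Complex.exp (((-2 * Real.pi * x * ξ : ℝ) : ℂ) * I) * η x =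
      (fun y => Z (y + b)) (a * x) := by
    intro x
    simp only [hZ, h, ← mul_assoc, ← Complex.exp_add]
    congr 2
    have : (a : ℂ) ≠ 0 := by exact_mod_cast ha
    push_cast
    field_simp
    ring
  rw [integral_congr_ae (Eventually.of_forall h1)]
  rw [Measure.integral_comp_mul_left (fun y => Z (y + b)) a, integral_add_right_eq_self Z, hZ,
    integral_const_mul]
  simp [abs_inv, mul_assoc]

lemma fourier_fourier (φ : SchwartzMap ℝ ℂ) (x : ℝ) :
    FourierTransform.fourier (FourierTransform.fourier φ) x = φ (-x) := by
  have h := congrArg (fun η : SchwartzMap ℝ ℂ => η (-x))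
    (FourierTransform.fourierInv_fourier_eq (F := SchwartzMap ℝ ℂ) φ)
  rw [show φ (-x) = _ from h.symm, SchwartzMap.fourierInv_coe, Real.fourierInv_eq_fourier_neg, neg_neg]
  rfl

lemma exp_norm_one (t : ℝ) : ‖Complex.exp (2 * Real.pi * I * (t : ℝ))‖ = 1 := by
  rw [show (2 * Real.pi * I * (t : ℝ) : ℂ) = ((2 * Real.pi * t : ℝ) : ℂ) * I by push_cast; ring]
  exact Complex.norm_exp_ofReal_mul_I _

/-- scaled Poisson summation -/
lemma poisson (L θ : ℝ) (hL : 0 < L) (φ : SchwartzMap ℝ ℂ) :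
    ∑' k : ℤ, Complex.exp (2 * Real.pi * I * (k * θ : ℝ)) * FourierTransform.fourier φ (k / L) =
      L * ∑' m : ℤ, φ (L * (θ + m)) := by
  obtain ⟨η, hη⟩ := exists_affC L 0 hL.ne' φ
  have h := SchwartzMap.tsum_eq_tsum_fourier η θ
  simp only [hη, add_zero] at h
  rw [h, ← tsum_mul_left]
  congr 1; ext k
  rw [fourier_affine L 0 hL.ne' φ η hη, fourier_coe_apply]
  have : (L : ℂ) ≠ 0 := by exact_mod_cast hL.ne'
  simp only [abs_of_pos hL]
  push_cast
  simp
  field_simp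

lemma exists_gauss : ∃ g : SchwartzMap ℝ ℂ, ∀ x, g x = (Real.exp (-(x ^ 2 / 2)) : ℝ) := by
  have hs : ContDiff ℝ (⊤ : ℕ∞) (fun x : ℝ => Real.exp (-(x ^ 2 / 2))) := by fun_prop
  have hb : ∀ k : ℕ, ∃ C, ∀ x : ℝ, |x| ^ k * Real.exp (-(x ^ 2 / 2)) ≤ C := by
    intro k
    refine ⟨k.factorial * Real.exp (1 / 2), fun x => ?_⟩
    have h1 : |x| ^ k ≤ k.factorial * Real.exp |x| := by
      have := Real.pow_div_factorial_le_exp |x| (abs_nonneg x) k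
      rw [div_le_iff₀ (by positivity)] at this
      linarith
    calc |x| ^ k * Real.exp (-(x ^ 2 / 2))
        ≤ k.factorial * Real.exp |x| * Real.exp (-(x ^ 2 / 2)) := by gcongr
      _ = k.factorial * Real.exp (|x| - x ^ 2 / 2) := by
          rw [mul_assoc, ← Real.exp_add]; rfl
      _ ≤ k.factorial * Real.exp (1 / 2) := by
          gcongr
          nlinarith [sq_nonneg (|x| - 1), sq_abs x]
  have hP : ∀ (P : Polynomial ℤ) (k : ℕ), ∃ C, ∀ x : ℝ,
      |x| ^ k * |Polynomial.aeval x P * Real.exp (-(x ^ 2 / 2))| ≤ C := by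
    intro P
    induction P using Polynomial.induction_on' with
    | add p q hp hq =>
      intro k
      obtain ⟨C, hC⟩ := hp k
      obtain ⟨D, hD⟩ := hq k
      refine ⟨C + D, fun x => ?_⟩
      rw [map_add, add_mul]
      refine (mul_le_mul_of_nonneg_left (abs_add_le _ _) (by positivity)).trans ?_
      rw [mul_add]
      exact add_le_add (hC x) (hD x)
    | monomial n a =>
      intro k
      obtain ⟨C, hC⟩ := hb (k + n)
      refine ⟨|(a : ℝ)| * C, fun x => ?_⟩
      have := mul_le_mul_of_nonneg_left (hC x) (abs_nonneg (a : ℝ))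
      refine le_trans (le_of_eq ?_) this
      simp [Polynomial.aeval_monomial, abs_mul, abs_pow, pow_add]
      ring
  let g0 : SchwartzMap ℝ ℝ :=
    { toFun := fun x : ℝ => Real.exp (-(x ^ 2 / 2))
      smooth' := hs
      decay' := by
        intro k n
        obtain ⟨C, hC⟩ := hP (Polynomial.hermite n) k
        refine ⟨C, fun x => ?_⟩
        rw [norm_iteratedFDeriv_eq_norm_iteratedDeriv, iteratedDeriv_eq_iterate,
          Polynomial.deriv_gaussian_eq_hermite_mul_gaussian]
        refine le_trans (le_of_eq ?_) (hC x)
        simp [abs_mul] }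
  refine ⟨SchwartzMap.postcompCLM Complex.ofRealCLM g0, fun x => ?_⟩
  rfl

/-- trigonometric polynomial vanishing on a block of integers. -/
lemma exists_trig (K : ℕ) (N : ℝ) : ∃ d : ℤ → ℂ, (∀ j, d (-j) = d j) ∧ d 0 = 1 ∧
    (∀ j, ‖d j‖ ≤ 1) ∧ ∀ k : ℤ, |k| ≤ K →
      ∑ j ∈ Finset.Icc (-(2 * K + 1 : ℤ)) (2 * K + 1),
        d j * Complex.exp (2 * Real.pi * I * (j * (k / N) : ℝ)) = 0 := by
  classical
  set E : ℝ → ℂ := fun t => Complex.exp (2 * Real.pi * I * (t : ℝ)) with hE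
  have hEadd : ∀ s t, E (s + t) = E s * E t := by
    intro s t; simp only [hE]; rw [← Complex.exp_add]; congr 1; push_cast; ring
  have hEne : ∀ t, E t ≠ 0 := fun t => Complex.exp_ne_zero _
  set G : Polynomial ℂ := ∏ k ∈ Finset.Icc (-(K : ℤ)) K,
    (Polynomial.X - Polynomial.C (E (k / N))) with hG
  have hGm : G.Monic := Polynomial.monic_prod_of_monic _ _ fun k _ => Polynomial.monic_X_sub_C _
  have hGd : G.natDegree = 2 * K + 1 := by
    rw [hG, Polynomial.natDegree_prod_of_monic _ _ fun k _ => Polynomial.monic_X_sub_C _]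
    simp
    omega
  obtain ⟨j0, hj0, hmax⟩ := Finset.exists_max_image (Finset.range (2 * K + 2))
    (fun j => ‖G.coeff j‖) ⟨0, by simp⟩
  have hmax' : ∀ j, ‖G.coeff j‖ ≤ ‖G.coeff j0‖ := by
    intro j
    by_cases hj : j < 2 * K + 2
    · exact hmax j (by simpa using hj)
    · rw [Polynomial.coeff_eq_zero_of_natDegree_lt (by omega)]; simp
  have hc0 : G.coeff j0 ≠ 0 := by
    intro h
    have := hmax' (2 * K + 1)
    rw [h, ← hGd, hGm.coeff_natDegree] at this
    simp at this
    linarith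
  have hj0' : j0 < 2 * K + 2 := by simpa using hj0
  set c : ℤ → ℂ := fun i => if 0 ≤ i then G.coeff i.toNat else 0 with hc
  have hcle : ∀ i, ‖c i‖ ≤ ‖G.coeff j0‖ := by
    intro i; simp only [hc]; split_ifs
    · exact hmax' _
    · simp
  set S : Finset ℤ := Finset.Icc (-(2 * K + 1 : ℤ)) (2 * K + 1) with hS
  have hsum : ∀ k : ℤ, |k| ≤ K → ∑ j ∈ S, c (j0 + j) * E (j * (k / N)) = 0 := by
    intro k hk
    have h0 : G.eval (E (k / N)) = 0 := by
      rw [hG, Polynomial.eval_prod]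
      exact Finset.prod_eq_zero (i := k) (by simpa [abs_le] using hk) (by simp)
    rw [Polynomial.eval_eq_sum_range, hGd] at h0
    have hpow : ∀ n : ℕ, E (k / N) ^ n = E (n * (k / N)) := by
      intro n; simp only [hE]; rw [← Complex.exp_nat_mul]; congr 1; push_cast; ring
    have h1 : ∑ i ∈ Finset.range (2 * K + 1 + 1), G.coeff i * E (k / N) ^ i =
        E (j0 * (k / N)) * ∑ j ∈ S, c (j0 + j) * E (j * (k / N)) := by
      rw [Finset.mul_sum]
      refine Finset.sum_of_injOn (fun i : ℕ => (i : ℤ) - j0) ?_ ?_ ?_ ?_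
      · intro a _ b _ h; simpa using h
      · intro i hi
        simp at hi
        simp [hS]
        omega
      · intro j _ hj'
        have : c (j0 + j) = 0 := by
          simp only [hc]
          split_ifs with h
          · refine Polynomial.coeff_eq_zero_of_natDegree_lt ?_
            rw [hGd]
            by_contra hlt
            apply hj'
            refine ⟨(j0 + j).toNat, ?_, ?_⟩
            · simp; omega
            · simp only; omega
          · rfl
        simp [this]
      · intro i hi
        rw [hpow]
        simp only [hc]
        rw [if_pos (by omega), show ((j0 : ℤ) + ((i : ℤ) - j0)).toNat = i by omega, mul_left_comm,
          ← hEadd]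
        congr 2
        push_cast
        ring
    rw [h1] at h0
    exact (mul_eq_zero.1 h0).resolve_left (hEne _)
  refine ⟨fun j => (c (j0 + j) + c (j0 - j)) / (2 * G.coeff j0), ?_, ?_, ?_, ?_⟩
  · intro j; simp only [sub_neg_eq_add, ← sub_eq_add_neg]; ring
  · simp [hc]; field_simp; norm_num
  · intro j
    rw [norm_div, div_le_one (by simp [hc0])]
    refine (norm_add_le _ _).trans ?_
    simp
    linarith [hcle (j0 + j), hcle (j0 - j)]
  · intro k hk
    have h1 := hsum k hk
    have h2 := hsum (-k) (by simpa using hk)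
    have h3 : ∑ j ∈ S, c (j0 + j) * E (j * ((-k : ℤ) / N)) =
        ∑ j ∈ S, c (j0 - j) * E (j * (k / N)) := by
      refine Finset.sum_equiv (Equiv.neg ℤ) ?_ ?_
      · intro i; simp [hS]; omega
      · intro i _
        simp
        left; congr 1; ring
    rw [h3] at h2
    have : ∑ j ∈ S, (c (j0 + j) + c (j0 - j)) / (2 * G.coeff j0) * E (j * (k / N)) =
        (∑ j ∈ S, c (j0 + j) * E (j * (k / N)) + ∑ j ∈ S, c (j0 - j) * E (j * (k / N)))
          / (2 * G.coeff j0) := by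
      rw [← Finset.sum_add_distrib, Finset.sum_div]
      refine Finset.sum_congr rfl fun j _ => by ring
    rw [h1, h2] at this
    rw [add_zero, zero_div] at this
    exact this
lemma ext_zero {ι : ℤ → ℝ} (hι : Function.Injective ι) (g : ℤ → ℂ) (x : ℝ)
    (h : ∀ m, ι m = x → g m = 0) : Function.extend ι g 0 x = 0 := by
  by_cases hx : ∃ m, ι m = x
  · obtain ⟨m, rfl⟩ := hx
    rw [hι.extend_apply, h m rfl]
  · rw [Function.extend_apply' _ _ _ hx]; rfl

lemma lat_inj (s b : ℝ) (hs : 0 < s) : Function.Injective (fun m : ℤ => s * m + b) := by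
  intro m n h
  have h' : s * (m : ℝ) = s * n := by simpa using h
  exact_mod_cast mul_left_cancel₀ hs.ne' h'

lemma lat_fin (s b R : ℝ) (hs : 0 < s) : {m : ℤ | |s * m + b| ≤ R}.Finite := by
  refine (Set.finite_Icc ⌊(-R - b) / s⌋ ⌈(R - b) / s⌉).subset fun m hm => ?_
  have h := abs_le.1 (show |s * (m : ℝ) + b| ≤ R from hm)
  constructor
  · have : ((⌊(-R - b) / s⌋ : ℤ) : ℝ) ≤ m := by
      refine (Int.floor_le _).trans ?_
      rw [div_le_iff₀ hs]; linarith [h.1]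
    exact_mod_cast this
  · have : (m : ℝ) ≤ ((⌈(R - b) / s⌉ : ℤ) : ℝ) := by
      refine le_trans ?_ (Int.le_ceil _)
      rw [le_div_iff₀ hs]; linarith [h.2]
    exact_mod_cast this

lemma testFn_bound (φ : SchwartzMap ℝ ℂ) (hφ : IsTestFn φ) : ∃ R : ℝ, ∀ x, φ x ≠ 0 → |x| ≤ R := by
  obtain ⟨R, hR⟩ := hφ.isCompact.isBounded.subset_closedBall 0
  exact ⟨R, fun x hx => by simpa using hR (subset_tsupport _ hx)⟩

lemma comb_LF (s b : ℝ) (hs : 0 < s) (g : ℤ → ℂ) :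
    LFw (Function.extend (fun m : ℤ => s * m + b) g 0) := by
  intro R
  refine ((lat_fin s b R hs).image (fun m : ℤ => s * m + b)).subset ?_
  rintro x ⟨hx, h⟩
  by_contra hn
  apply h
  refine ext_zero (lat_inj s b hs) g x fun m hm => ?_
  exact absurd ⟨m, by simpa [hm] using hx, hm⟩ hn

lemma comb_hasSum (s b : ℝ) (hs : 0 < s) (g : ℤ → ℂ) (φ : SchwartzMap ℝ ℂ) (hφ : IsTestFn φ) :
    HasSum (fun x => Function.extend (fun m : ℤ => s * m + b) g 0 x * φ x)
      (∑' m : ℤ, g m * φ (s * m + b)) := by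
  have hi := lat_inj s b hs
  rw [← hi.hasSum_iff]
  · have : ((fun x => Function.extend (fun m : ℤ => s * m + b) g 0 x * φ x) ∘
        fun m : ℤ => s * m + b) = fun m : ℤ => g m * φ (s * m + b) := by
      ext m
      simp only [Function.comp]
      rw [hi.extend_apply]
    rw [this]
    refine Summable.hasSum (summable_of_hasFiniteSupport ?_)
    obtain ⟨R, hR⟩ := testFn_bound φ hφ
    refine (lat_fin s b R hs).subset fun m hm => hR _ ?_
    exact right_ne_zero_of_mul hm
  · intro x hx
    rw [Function.extend_apply' _ _ _ (by simpa using hx)]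
    simp

lemma schwartz_bd (φ : SchwartzMap ℝ ℂ) (n : ℕ) (x : ℝ) :
    |x| ^ n * ‖φ x‖ ≤ SchwartzMap.seminorm ℂ n 0 φ := by
  simpa using SchwartzMap.norm_pow_mul_le_seminorm ℂ φ n x

lemma summable_lat (φ : SchwartzMap ℝ ℂ) (L : ℝ) (hL : 0 < L) :
    Summable (fun k : ℤ => ‖φ (k / L)‖) := by
  have h1 : Summable (fun k : ℤ => L ^ 2 * SchwartzMap.seminorm ℂ 2 0 φ * (1 / (k : ℝ) ^ 2)) :=
    (Real.summable_one_div_int_pow.2 one_lt_two).mul_left _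
  refine Summable.of_norm_bounded_eventually h1 ?_
  have : {x : ℤ | x ≠ 0} ∈ (cofinite : Filter ℤ) :=
    (Set.finite_singleton (0 : ℤ)).compl_mem_cofinite
  filter_upwards [this] with k hk
  have hk' : (0 : ℝ) < (k : ℝ) ^ 2 := by positivity
  have := schwartz_bd φ 2 (k / L)
  rw [sq_abs, div_pow] at this
  rw [norm_norm, mul_one_div, le_div_iff₀ hk']
  have h3 : (k : ℝ) ^ 2 * ‖φ (k / L)‖ = L ^ 2 * ((k : ℝ) ^ 2 / L ^ 2 * ‖φ (k / L)‖) := by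
    field_simp
  rw [mul_comm, h3]
  gcongr

lemma block (ℓ : ℕ) (hℓ : 1 ≤ ℓ) (a : ℂ) (ε : ℝ) (hε : 0 < ε) :
    ∃ (f : ℤ → ℂ) (w : ℝ → ℂ) (v : ℤ → ℝ),
      (∀ k, f (-k) = f k) ∧ (∀ k, 0 ≤ v k) ∧ Summable v ∧ ∑' k, v k ≤ ε ∧
      (∀ k : ℤ, ‖f k‖ ≤ v k * |(k : ℝ) / (2 * ℓ)| ^ 4) ∧
      (∀ φ : SchwartzMap ℝ ℂ, IsTestFn φ → HasSum (fun x => w x * φ x)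
        (∑' k : ℤ, f k * (φ ((k : ℝ) / (2 * ℓ)) +
          FourierTransform.fourier φ ((k : ℝ) / (2 * ℓ))))) ∧
      LFw w ∧ (∀ x : ℝ, |x| < ℓ - 1 → w x = 0) ∧ w ℓ = a := by
  classical
  set L : ℝ := 2 * ℓ with hL
  have hℓ' : (1 : ℝ) ≤ ℓ := by exact_mod_cast hℓ
  have hL0 : 0 < L := by positivity
  have hL2 : 2 ≤ L := by linarith
  have hLc : (L : ℂ) ≠ 0 := by exact_mod_cast hL0.ne'
  set Z : ℝ := ∑' k : ℤ, 1 / (k : ℝ) ^ 2 with hZ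
  have hZs : Summable (fun k : ℤ => 1 / (k : ℝ) ^ 2) := Real.summable_one_div_int_pow.2 one_lt_two
  have hZ0 : 0 ≤ Z := tsum_nonneg fun k => by positivity
  obtain ⟨K, hK⟩ := exists_nat_ge (max (max 1 (L * ℓ)) (‖a‖ * L ^ 3 * 7 * Z / ε))
  have hK1 : (1 : ℝ) ≤ K := (le_max_left _ _).trans ((le_max_left _ _).trans hK)
  have hK2 : L * ℓ ≤ K := (le_max_right _ _).trans ((le_max_left _ _).trans hK)
  have hK3 : ‖a‖ * L ^ 3 * 7 * Z / ε ≤ K := (le_max_right _ _).trans hK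
  set p : ℝ := 2 * K + 1 with hp
  have hp0 : 0 < p := by positivity
  obtain ⟨d, hdev, hd0, hd1, hdv⟩ := exists_trig K (L * p)
  set S : Finset ℤ := Finset.Icc (-(2 * K + 1 : ℤ)) (2 * K + 1) with hS
  have hScard : (S.card : ℝ) = 4 * K + 3 := by
    have : S.card = 4 * K + 3 := by simp [hS]; omega
    rw [this]; push_cast; ring
  have hSp : ∀ j ∈ S, |(j : ℝ) / p| ≤ 1 := by
    intro j hj
    simp only [hS, Finset.mem_Icc] at hj
    rw [abs_div, abs_of_pos hp0, div_le_one hp0, abs_le, hp]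
    constructor
    · exact_mod_cast hj.1
    · exact_mod_cast hj.2
  set E : ℝ → ℂ := fun t => Complex.exp (2 * Real.pi * I * (t : ℝ)) with hE
  have hEadd : ∀ s t, E (s + t) = E s * E t := by
    intro s t; simp only [hE]; rw [← Complex.exp_add]; congr 1; push_cast; ring
  have hEn : ∀ t, ‖E t‖ = 1 := exp_norm_one
  have hEint : ∀ k : ℤ, E k = 1 := by
    intro k; simp only [hE]; rw [Complex.exp_eq_one_iff]; exact ⟨k, by push_cast; ring⟩
  set θ : ℤ → ℝ := fun j => 1 / 2 + j / (L * p) with hθ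
  set f : ℤ → ℂ := fun k => ∑ j ∈ S, (a / L * d j) * E (k * θ j) with hf
  have hfb : ∀ k, ‖f k‖ ≤ ‖a‖ / L * (4 * K + 3) := by
    intro k
    have : ∀ j ∈ S, ‖(a / L * d j) * E (k * θ j)‖ ≤ ‖a‖ / L := by
      intro j _
      rw [norm_mul, hEn, mul_one, norm_mul, norm_div, Complex.norm_real, Real.norm_eq_abs,
        abs_of_pos hL0]
      exact mul_le_of_le_one_right (by positivity) (hd1 j)
    refine (norm_sum_le_of_le _ this).trans ?_
    rw [Finset.sum_const, nsmul_eq_mul, hScard]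
    linarith
  have hf0 : ∀ k : ℤ, |k| ≤ K → f k = 0 := by
    intro k hk
    have h1 : f k = a / L * E (k / 2) * ∑ j ∈ S, d j * E (j * (k / (L * p))) := by
      simp only [hf]
      rw [Finset.mul_sum]
      refine Finset.sum_congr rfl fun j _ => ?_
      rw [show (k : ℝ) * θ j = k / 2 + j * (k / (L * p)) by simp only [hθ]; ring, hEadd]
      ring
    rw [h1, hdv k hk, mul_zero]
  have hfev : ∀ k, f (-k) = f k := by
    intro k
    simp only [hf]
    refine Finset.sum_equiv (Equiv.neg ℤ) ?_ ?_
    · intro i; simp [hS]; omega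
    · intro j _
      simp only [Equiv.neg_apply, hdev]
      congr 1
      rw [show (k : ℝ) * θ (-j) = k + ((-k : ℤ) : ℝ) * θ j by
        simp only [hθ]; push_cast; ring, hEadd, hEint, one_mul]
  set v : ℤ → ℝ := fun k => ‖a‖ * L ^ 3 * (4 * K + 3) / K ^ 2 * (1 / (k : ℝ) ^ 2) with hv
  have hvs : Summable v := hZs.mul_left _
  have hfv : ∀ k : ℤ, ‖f k‖ ≤ v k * |(k : ℝ) / L| ^ 4 := by
    intro k
    by_cases hk : |k| ≤ K
    · rw [hf0 k hk, norm_zero]; positivity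
    · have hk' : (K : ℝ) ≤ |(k : ℝ)| := by
        have : (K : ℤ) ≤ |k| := by omega
        exact_mod_cast this
      have hk0 : (k : ℝ) ≠ 0 := by
        intro h; rw [h] at hk'; rw [abs_zero] at hk'; linarith
      refine (hfb k).trans ?_
      have : v k * |(k : ℝ) / L| ^ 4 = ‖a‖ / L * (4 * K + 3) * ((k : ℝ) ^ 2 / K ^ 2) := by
        simp only [hv]
        rw [show |(k : ℝ) / L| ^ 4 = ((k : ℝ) / L) ^ 4 by
          rw [← abs_pow, abs_of_nonneg (by positivity)]]
        have : (K : ℝ) ≠ 0 := by positivity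
        field_simp
      rw [this]
      refine le_mul_of_one_le_right (by positivity) ?_
      rw [one_le_div (by positivity), ← sq_abs (k : ℝ)]
      gcongr
  have hsum1 : ∀ φ : SchwartzMap ℝ ℂ, Summable (fun k : ℤ => f k * φ ((k : ℝ) / L)) := by
    intro φ
    refine Summable.of_norm_bounded ((summable_lat φ L hL0).mul_left (‖a‖ / L * (4 * K + 3))) ?_
    intro k
    rw [norm_mul]
    gcongr
    exact hfb k
  set w1 : ℝ → ℂ := Function.extend (fun m : ℤ => L⁻¹ * m + 0) f 0 with hw1
  set e : ℤ → ℝ → ℂ := fun j => Function.extend (fun m : ℤ => L * m + (ℓ + j / p)) 1 0 with he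
  set w2 : ℝ → ℂ := fun x => ∑ j ∈ S, a * d j * e j x with hw2
  have hLi : 0 < L⁻¹ := by positivity
  refine ⟨f, fun x => w1 x + w2 x, v, hfev, fun k => by positivity, hvs, ?_, hfv, ?_, ?_, ?_, ?_⟩
  · simp only [hv]
    rw [tsum_mul_left, ← hZ]
    rw [div_le_iff₀ hε] at hK3
    have : ‖a‖ * L ^ 3 * (4 * K + 3) / K ^ 2 * Z ≤ ‖a‖ * L ^ 3 * (7 * K) / K ^ 2 * Z := by
      gcongr; linarith
    refine this.trans ?_
    rw [div_mul_eq_mul_div, div_le_iff₀ (by positivity)]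
    nlinarith [mul_le_mul_of_nonneg_left hK3 (zero_le_one.trans hK1)]
  · intro φ hφ
    have h1 := comb_hasSum L⁻¹ 0 hLi f φ hφ
    have h2 : HasSum (fun x => w2 x * φ x)
        (∑ j ∈ S, a * d j * ∑' m : ℤ, φ (L * m + (ℓ + j / p))) := by
      have : ∀ j ∈ S, HasSum (fun x => a * d j * (e j x * φ x))
          (a * d j * ∑' m : ℤ, φ (L * m + (ℓ + j / p))) := by
        intro j _
        have := (comb_hasSum L (ℓ + j / p) hL0 1 φ hφ).mul_left (a * d j)
        simpa only [Pi.one_apply, one_mul] using this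
      have := hasSum_sum this
      have hfun : (fun x => w2 x * φ x) = fun x => ∑ j ∈ S, a * d j * (e j x * φ x) := by
        ext x; simp only [hw2, Finset.sum_mul, mul_assoc]
      rw [hfun]
      exact this
    have h3 : ∑' k : ℤ, f k * (φ ((k : ℝ) / L) + FourierTransform.fourier φ ((k : ℝ) / L)) =
        (∑' m : ℤ, f m * φ (L⁻¹ * m + 0)) +
          ∑ j ∈ S, a * d j * ∑' m : ℤ, φ (L * m + (ℓ + j / p)) := by
      simp only [mul_add]
      rw [(hsum1 φ).tsum_add (hsum1 _)]
      congr 1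
      · congr 1; ext m; congr 2; field_simp; simp
      · simp only [hf, Finset.sum_mul]
        rw [Summable.tsum_finsetSum]
        · refine Finset.sum_congr rfl fun j _ => ?_
          simp only [mul_assoc]
          rw [tsum_mul_left, tsum_mul_left]
          have := poisson L (θ j) hL0 φ
          simp only [hE]
          rw [this]
          have h5 : ∀ m : ℤ, L * (θ j + m) = L * m + (ℓ + j / p) := by
            intro m; simp only [hθ]; rw [hL]; field_simp
            ring
          simp only [h5]
          generalize (∑' m : ℤ, φ (L * m + (ℓ + j / p))) = q
          field_simp
        · intro j _
          refine Summable.of_norm_bounded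
            ((summable_lat (FourierTransform.fourier φ) L hL0).mul_left (‖a / L * d j‖)) ?_
          intro k
          rw [norm_mul, norm_mul, hEn, mul_one]
    rw [h3]
    simpa only [add_mul] using h1.add h2
  · refine (comb_LF L⁻¹ 0 hLi f).add ?_
    intro R
    refine (Set.Finite.biUnion S.finite_toSet
      (fun j _ => comb_LF L (ℓ + j / p) hL0 1 R)).subset ?_
    rintro x ⟨hx, h⟩
    obtain ⟨j, hj, hj'⟩ := Finset.exists_ne_zero_of_sum_ne_zero h
    exact Set.mem_biUnion (x := j) (by simpa using hj) ⟨hx, right_ne_zero_of_mul hj'⟩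
  all_goals
    have hw1z : ∀ x : ℝ, |x| ≤ ℓ → w1 x = 0 := by
      intro x hx
      refine ext_zero (lat_inj L⁻¹ 0 hLi) f x fun m hm => hf0 m ?_
      have : (m : ℝ) = L * x := by rw [← hm]; field_simp; ring
      have h2 : |(m : ℝ)| ≤ K := by
        rw [this, abs_mul, abs_of_pos hL0]
        exact (mul_le_mul_of_nonneg_left hx hL0.le).trans hK2
      exact_mod_cast h2
  · intro x hx
    show w1 x + w2 x = 0
    rw [hw1z x (by linarith), zero_add]
    refine Finset.sum_eq_zero fun j hj => ?_
    rw [show e j x = 0 from ext_zero (lat_inj L _ hL0) 1 x fun m hm => ?_, mul_zero]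
    exfalso
    have h1 := hSp j hj
    have h2 : (ℓ : ℝ) ≤ |L * m + ℓ| := by
      rw [show L * m + ℓ = ℓ * ((2 * m + 1 : ℤ) : ℝ) by rw [hL]; push_cast; ring, abs_mul,
        abs_of_nonneg (by linarith : (0:ℝ) ≤ ℓ)]
      refine le_mul_of_one_le_right (by linarith) ?_
      have : (1 : ℤ) ≤ |2 * m + 1| := Int.one_le_abs (by omega)
      exact_mod_cast this
    have h3 := abs_sub_abs_le_abs_sub (L * m + ℓ) (-(j / p))
    rw [abs_neg, sub_neg_eq_add, add_assoc, hm] at h3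
    linarith
  · show w1 ℓ + w2 ℓ = a
    rw [hw1z ℓ (by simp), zero_add]
    simp only [hw2]
    rw [Finset.sum_eq_single 0]
    · have : e 0 ((L * (0 : ℤ) + (ℓ + (0 : ℤ) / p) : ℝ)) = 1 := by
        simp only [he]
        exact (lat_inj L (ℓ + (0 : ℤ) / p) hL0).extend_apply 1 0 (0 : ℤ)
      simp at this
      rw [this, hd0]; simp
    · intro j hj hj0
      rw [show e j ℓ = 0 from ext_zero (lat_inj L _ hL0) 1 _ fun m hm => ?_, mul_zero]
      exfalso
      have h1 := hSp j hj
      have h2 : L * m = - (j / p) := by linarith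
      have h3 : |L * m| ≤ 1 := by rw [h2, abs_neg]; exact h1
      rw [abs_mul, abs_of_pos hL0] at h3
      have hm0 : m = 0 := by
        by_contra hne
        have : (1 : ℝ) ≤ |(m : ℝ)| := by exact_mod_cast Int.one_le_abs hne
        nlinarith
      rw [hm0] at h2
      simp at h2
      rcases h2 with h | h
      · exact hj0 h
      · exact hp0.ne' h
    · intro h; exfalso; apply h; simp [hS]; omega

def ampSeq (w : ℕ → ℂ → ℝ → ℂ) (A : ℕ → ℂ) : ℕ → ℂ
  | n => A n - ∑ m : Fin n, w m (ampSeq w A m) ((2 * n + 2 : ℕ) : ℝ)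
termination_by n => n
decreasing_by exact m.2

lemma combine : ∃ (u : ℕ × ℤ → ℂ) (x : ℕ × ℤ → ℝ) (V : ℕ × ℤ → ℝ) (W : ℝ → ℂ)
    (σ : Equiv.Perm (ℕ × ℤ)), Summable V ∧ (∀ i, 0 ≤ V i) ∧ (∀ i, ‖u i‖ ≤ V i * |x i| ^ 4) ∧
    (∀ i, u (σ i) = u i) ∧ (∀ i, x (σ i) = - x i) ∧ LFw W ∧
    (∀ n : ℕ, W ((2 * n + 2 : ℕ) : ℝ) =
      ((((n : ℝ) + 1) * Real.exp (((2 * n + 2 : ℕ) : ℝ) ^ 2 / 2) : ℝ) : ℂ)) ∧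
    (∀ φ : SchwartzMap ℝ ℂ, IsTestFn φ → HasSum (fun y => W y * φ y)
      (∑' i, u i * φ (x i) + ∑' i, u i * FourierTransform.fourier φ (x i))) := by
  classical
  choose f' w' v' h1' h2' h3' h4' h5' h6' h7' h8' h9' using
    fun (n : ℕ) (a : ℂ) => block (2 * n + 2) (by omega) a ((1 / 2) ^ n) (by positivity)
  set A : ℕ → ℂ := fun n =>
    ((((n : ℝ) + 1) * Real.exp (((2 * n + 2 : ℕ) : ℝ) ^ 2 / 2) : ℝ) : ℂ) with hA
  set am := ampSeq w' A with ham
  have hrec : ∀ n, am n = A n - ∑ m ∈ Finset.range n, w' m (am m) ((2 * n + 2 : ℕ) : ℝ) := by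
    intro n
    rw [ham, ampSeq, Finset.sum_range (fun m => w' m (ampSeq w' A m) ((2 * n + 2 : ℕ) : ℝ))]
  set f : ℕ → ℤ → ℂ := fun n => f' n (am n) with hf
  set w : ℕ → ℝ → ℂ := fun n => w' n (am n) with hw
  set v : ℕ → ℤ → ℝ := fun n => v' n (am n) with hv
  have h1 : ∀ n k, f n (-k) = f n k := fun n => h1' n (am n)
  have h2 : ∀ n k, 0 ≤ v n k := fun n => h2' n (am n)
  have h3 : ∀ n, Summable (v n) := fun n => h3' n (am n)
  have h4 : ∀ n, ∑' k, v n k ≤ (1 / 2) ^ n := fun n => h4' n (am n)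
  have h5 : ∀ n (k : ℤ), ‖f n k‖ ≤ v n k * |(k : ℝ) / (2 * (2 * n + 2 : ℕ))| ^ 4 :=
    fun n => h5' n (am n)
  have h6 := fun n => h6' n (am n)
  have h7 : ∀ n, LFw (w n) := fun n => h7' n (am n)
  have h8 : ∀ n (x : ℝ), |x| < ((2 * n + 2 : ℕ) : ℝ) - 1 → w n x = 0 := fun n => h8' n (am n)
  have h9 : ∀ n, w n ((2 * n + 2 : ℕ) : ℝ) = am n := fun n => h9' n (am n)
  have h8b : ∀ (M : ℕ) (x : ℝ), |x| < 2 * M + 1 → ∀ m, M ≤ m → w m x = 0 := by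
    intro M x hx m hm
    apply h8
    push_cast
    have : (M : ℝ) ≤ m := by exact_mod_cast hm
    linarith
  set W : ℝ → ℂ := fun x => ∑' m, w m x with hW
  have hWM : ∀ (M : ℕ) (x : ℝ), |x| < 2 * M + 1 → W x = ∑ m ∈ Finset.range M, w m x := by
    intro M x hx
    exact tsum_eq_sum fun m hm => h8b M x hx m (by simpa using hm)
  set V : ℕ × ℤ → ℝ := fun i => v i.1 i.2 with hV
  set u : ℕ × ℤ → ℂ := fun i => f i.1 i.2 with hu
  set X : ℕ × ℤ → ℝ := fun i => (i.2 : ℝ) / (2 * (2 * i.1 + 2 : ℕ)) with hX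
  have hVs : Summable V := by
    rw [summable_prod_of_nonneg (fun i => h2 _ _)]
    refine ⟨h3, ?_⟩
    exact Summable.of_nonneg_of_le (fun n => tsum_nonneg (h2 n)) h4
      (summable_geometric_of_lt_one (by norm_num) (by norm_num))
  have hub : ∀ i, ‖u i‖ ≤ V i * |X i| ^ 4 := fun i => h5 i.1 i.2
  have hsm : ∀ φ : SchwartzMap ℝ ℂ, Summable (fun i => u i * φ (X i)) := by
    intro φ
    refine Summable.of_norm_bounded (hVs.mul_right (SchwartzMap.seminorm ℂ 4 0 φ)) fun i => ?_
    rw [norm_mul]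
    calc ‖u i‖ * ‖φ (X i)‖ ≤ V i * |X i| ^ 4 * ‖φ (X i)‖ := by gcongr; exact hub i
      _ = V i * (|X i| ^ 4 * ‖φ (X i)‖) := by ring
      _ ≤ _ := mul_le_mul_of_nonneg_left (schwartz_bd φ 4 _) (h2 _ _)
  refine ⟨u, X, V, W, (Equiv.refl ℕ).prodCongr (Equiv.neg ℤ), hVs, fun i => h2 _ _, hub,
    fun i => h1 _ _, ?_, ?_, ?_, ?_⟩
  · rintro ⟨n, k⟩
    simp [hX, neg_div]
  · intro R
    obtain ⟨M, hM⟩ := exists_nat_ge R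
    refine (Set.Finite.biUnion (Finset.range M).finite_toSet (fun n _ => h7 n R)).subset ?_
    rintro x ⟨hx, h⟩
    rw [hWM M x (by have : (0:ℝ) ≤ M := M.cast_nonneg; linarith)] at h
    obtain ⟨j, hj, hj'⟩ := Finset.exists_ne_zero_of_sum_ne_zero h
    exact Set.mem_biUnion (x := j) (by simpa using hj) ⟨hx, hj'⟩
  · intro n
    rw [hWM (n + 1) _ (by rw [abs_of_nonneg (by positivity)]; push_cast; linarith),
      Finset.sum_range_succ, h9, hrec n]
    simp only [hw, hA]
    ring
  · intro φ hφ
    obtain ⟨R, hR⟩ := testFn_bound φ hφ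
    obtain ⟨M, hM⟩ := exists_nat_ge R
    have hR' : ∀ x, φ x ≠ 0 → |x| < 2 * M + 1 := by
      intro x hx
      have : (0:ℝ) ≤ M := M.cast_nonneg
      linarith [hR x hx]
    have hz : ∀ m, M ≤ m → (∑' k : ℤ, f m k * (φ ((k : ℝ) / (2 * (2 * m + 2 : ℕ))) +
          FourierTransform.fourier φ ((k : ℝ) / (2 * (2 * m + 2 : ℕ))))) = 0 := by
      intro m hm
      have := h6 m φ hφ
      refine this.unique ?_
      have h0 : (fun x => w' m (am m) x * φ x) = fun _ => 0 := by
        ext x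
        by_cases hx : φ x = 0
        · rw [hx, mul_zero]
        · rw [show w' m (am m) x = 0 from h8b M x (hR' x hx) m hm, zero_mul]
      rw [h0]
      exact hasSum_zero
    have e1 : ∑' i, u i * φ (X i) + ∑' i, u i * FourierTransform.fourier φ (X i) =
        ∑ m ∈ Finset.range M, (∑' k : ℤ, f m k * (φ ((k : ℝ) / (2 * (2 * m + 2 : ℕ))) +
          FourierTransform.fourier φ ((k : ℝ) / (2 * (2 * m + 2 : ℕ))))) := by
      rw [← (hsm φ).tsum_add (hsm _)]
      simp only [← mul_add]
      have hs : Summable (fun i => u i * (φ (X i) + FourierTransform.fourier φ (X i))) := by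
        simpa only [mul_add] using (hsm φ).add (hsm _)
      rw [hs.tsum_prod]
      exact tsum_eq_sum fun m hm => hz m (by simpa using hm)
    rw [e1]
    have hfun : (fun y => W y * φ y) = fun y => ∑ m ∈ Finset.range M, w m y * φ y := by
      ext x
      by_cases hx : φ x = 0
      · simp [hx]
      · rw [hWM M x (hR' x hx), Finset.sum_mul]
    rw [hfun]
    exact hasSum_sum fun m _ => h6 m φ hφ

lemma exists_bump : ∃ χ : SchwartzMap ℝ ℂ, χ 0 = 1 ∧ (∀ x, ‖χ x‖ ≤ 1) ∧
    (∀ x, 1 ≤ |x| → χ x = 0) := by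
  let b : ContDiffBump (0 : ℝ) := ⟨1 / 2, 1, by norm_num, by norm_num⟩
  have hc : HasCompactSupport (fun x => ((b x : ℝ) : ℂ)) :=
    b.hasCompactSupport.comp_left (g := fun r : ℝ => (r : ℂ)) (by simp)
  have hd : ContDiff ℝ (⊤ : ℕ∞) (fun x => ((b x : ℝ) : ℂ)) :=
    Complex.ofRealCLM.contDiff.comp b.contDiff
  refine ⟨hc.toSchwartzMap hd, ?_, ?_, ?_⟩
  · show ((b 0 : ℝ) : ℂ) = 1
    rw [b.one_of_mem_closedBall (by simp [b])]; simp
  · intro x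
    show ‖((b x : ℝ) : ℂ)‖ ≤ 1
    rw [Complex.norm_real, Real.norm_eq_abs, abs_of_nonneg b.nonneg]
    exact b.le_one
  · intro x hx
    show ((b x : ℝ) : ℂ) = 0
    rw [b.zero_of_le_dist (by simpa [b] using hx)]; simp

lemma exists_conv (χ ψ : SchwartzMap ℝ ℂ) (c δ : ℝ) (hδ : 0 < δ) :
    ∃ h φ : SchwartzMap ℝ ℂ, (∀ x, φ x = ∫ y, h y * ψ (x - y)) ∧
      (∀ ξ, FourierTransform.fourier φ ξ =
        χ (δ⁻¹ * ξ + (-(δ⁻¹ * c))) * FourierTransform.fourier ψ ξ) ∧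
      ∫ y, ‖h y‖ = ∫ y, ‖FourierTransform.fourier χ y‖ := by
  obtain ⟨η, hη⟩ := exists_affC δ⁻¹ (-(δ⁻¹ * c)) (inv_pos.2 hδ).ne' χ
  have hh : FourierTransform.fourier (FourierTransformInv.fourierInv η) = η :=
    FourierTransform.fourier_fourierInv_eq (F := SchwartzMap ℝ ℂ) η
  set h : SchwartzMap ℝ ℂ := FourierTransformInv.fourierInv η with hhd
  refine ⟨h, SchwartzMap.convolution (ContinuousLinearMap.mul ℂ ℂ) h ψ, ?_, ?_, ?_⟩
  · intro x
    rw [SchwartzMap.convolution_apply]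
    rfl
  · intro ξ
    rw [SchwartzMap.fourier_convolution, hh, ← hη]
    rfl
  · have h1 : ∀ y, ‖h y‖ = δ * ‖FourierTransform.fourier χ (-δ * y)‖ := by
      intro y
      have := fourier_fourier h (-y)
      rw [neg_neg, hh] at this
      rw [← this, fourier_affine δ⁻¹ _ (inv_pos.2 hδ).ne' χ η hη, norm_mul, norm_mul,
        exp_norm_one, mul_one, Complex.norm_real]
      congr 1
      · simp [abs_of_pos hδ]
      · congr 2; field_simp
    simp only [h1]
    rw [integral_const_mul,
      Measure.integral_comp_mul_left (fun z => ‖FourierTransform.fourier χ z‖) (-δ)]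
    rw [abs_inv, abs_neg, abs_of_pos hδ, smul_eq_mul, ← mul_assoc, mul_inv_cancel₀ hδ.ne', one_mul]

section final

variable {u : ℕ × ℤ → ℂ} {x V : ℕ × ℤ → ℝ} 

lemma u_bd (hV0 : ∀ i, 0 ≤ V i) (hu : ∀ i, ‖u i‖ ≤ V i * |x i| ^ 4)
    (z : ℂ) (C : ℝ) (i : ℕ × ℤ) (hC : |x i| ^ 4 * ‖z‖ ≤ C) : ‖u i * z‖ ≤ V i * C := by
  rw [norm_mul]
  calc ‖u i‖ * ‖z‖ ≤ V i * |x i| ^ 4 * ‖z‖ := by gcongr; exact hu i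
    _ = V i * (|x i| ^ 4 * ‖z‖) := by ring
    _ ≤ _ := mul_le_mul_of_nonneg_left hC (hV0 i)

lemma exists_U (hVs : Summable V) (hV0 : ∀ i, 0 ≤ V i) (hu : ∀ i, ‖u i‖ ≤ V i * |x i| ^ 4) :
    ∃ U : SchwartzMap ℝ ℂ →L[ℂ] ℂ, (∀ φ, U φ = ∑' i, u i * φ (x i)) ∧
      (∀ φ : SchwartzMap ℝ ℂ, Summable (fun i => u i * φ (x i))) ∧
      (∀ (φ : SchwartzMap ℝ ℂ) (C : ℝ), (∀ y, |y| ^ 4 * ‖φ y‖ ≤ C) → ‖U φ‖ ≤ (∑' i, V i) * C) := by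
  have hs : ∀ φ : SchwartzMap ℝ ℂ, Summable (fun i => u i * φ (x i)) := fun φ =>
    Summable.of_norm_bounded (hVs.mul_right (SchwartzMap.seminorm ℂ 4 0 φ))
      fun i => u_bd hV0 hu _ _ i (schwartz_bd φ 4 _)
  have hb : ∀ (φ : SchwartzMap ℝ ℂ) (C : ℝ), (∀ y, |y| ^ 4 * ‖φ y‖ ≤ C) →
      ‖∑' i, u i * φ (x i)‖ ≤ (∑' i, V i) * C := by
    intro φ C hC
    rw [← tsum_mul_right]
    exact tsum_of_norm_bounded (hVs.mul_right C).hasSum fun i => u_bd hV0 hu _ _ i (hC _)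
  refine ⟨SchwartzMap.mkCLMtoNormedSpace (fun φ => ∑' i, u i * φ (x i)) ?_ ?_ ?_, ?_, hs, hb⟩
  · intro φ η
    rw [← (hs φ).tsum_add (hs η)]
    simp [mul_add]
  · intro a φ
    simp only [smul_apply, smul_eq_mul, RingHom.id_apply]
    rw [← tsum_mul_left]
    congr 1; ext i; ring
  · refine ⟨{(4, 0)}, ∑' i, V i, tsum_nonneg hV0, fun φ => ?_⟩
    refine hb φ _ fun y => ?_
    simpa using schwartz_bd φ 4 y
  · intro φ; rfl

lemma conv_bound (hVs : Summable V) (hV0 : ∀ i, 0 ≤ V i) (hu : ∀ i, ‖u i‖ ≤ V i * |x i| ^ 4)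
    (σ : Equiv.Perm (ℕ × ℤ)) (hσu : ∀ i, u (σ i) = u i) (hσx : ∀ i, x (σ i) = - x i)
    (h φ ψ : SchwartzMap ℝ ℂ) (hφ : ∀ t, φ t = ∫ y, h y * ψ (t - y)) (B : ℝ)
    (hB : ∀ y, ‖∑' i, u i * transRefl y ψ (x i)‖ ≤ B) :
    ‖∑' i, u i * φ (x i)‖ ≤ B * ∫ y, ‖h y‖ := by
  set F : ℕ × ℤ → ℝ → ℂ := fun i y => u i * (h y * ψ (x i - y)) with hF
  have hψ0 : ∀ y, ‖ψ y‖ ≤ SchwartzMap.seminorm ℂ 0 0 ψ := fun y => by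
    simpa using schwartz_bd ψ 0 y
  have hint : ∀ i, Integrable (fun y => h y * ψ (x i - y)) := by
    intro i
    refine (h.integrable (μ := volume)).mul_bdd (c := SchwartzMap.seminorm ℂ 0 0 ψ) ?_ ?_
    · exact (ψ.continuous.comp (by fun_prop)).aestronglyMeasurable
    · exact Eventually.of_forall fun y => hψ0 _
  have hFi : ∀ i, Integrable (F i) := fun i => (hint i).const_mul _
  set G : ℝ → ℝ := fun y => 8 * SchwartzMap.seminorm ℂ 4 0 ψ * ‖h y‖ +
    8 * SchwartzMap.seminorm ℂ 0 0 ψ * (‖y‖ ^ 4 * ‖h y‖) with hG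
  have hGi : Integrable G :=
    (h.integrable.norm.const_mul _).add ((h.integrable_pow_mul volume 4).const_mul _)
  have hFG : ∀ i y, ‖F i y‖ ≤ V i * G y := by
    intro i y
    apply u_bd hV0 hu
    rw [norm_mul]
    have h1 : |x i| ^ 4 ≤ 8 * (|x i - y| ^ 4 + |y| ^ 4) := by
      have ha : |x i| ≤ |x i - y| + |y| := by
        simpa using abs_add_le (x i - y) y
      calc |x i| ^ 4 ≤ (|x i - y| + |y|) ^ 4 := by gcongr
        _ ≤ _ := by
          have := add_pow_le (abs_nonneg (x i - y)) (abs_nonneg y) 4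
          norm_num at this
          exact this
    have h2 := schwartz_bd ψ 4 (x i - y)
    have h3 := hψ0 (x i - y)
    calc |x i| ^ 4 * (‖h y‖ * ‖ψ (x i - y)‖)
        ≤ 8 * (|x i - y| ^ 4 + |y| ^ 4) * (‖h y‖ * ‖ψ (x i - y)‖) := by gcongr
      _ = 8 * (|x i - y| ^ 4 * ‖ψ (x i - y)‖) * ‖h y‖ +
          8 * ‖ψ (x i - y)‖ * (|y| ^ 4 * ‖h y‖) := by ring
      _ ≤ 8 * SchwartzMap.seminorm ℂ 4 0 ψ * ‖h y‖ +
          8 * SchwartzMap.seminorm ℂ 0 0 ψ * (|y| ^ 4 * ‖h y‖) := by gcongr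
      _ = G y := rfl
  have hFs : Summable fun i => ∫ y, ‖F i y‖ := by
    refine Summable.of_nonneg_of_le (fun i => integral_nonneg fun y => norm_nonneg _) (fun i => ?_)
      (hVs.mul_right (∫ y, G y))
    rw [← integral_const_mul]
    exact integral_mono (hFi i).norm (hGi.const_mul _) (hFG i)
  have key := (hasSum_integral_of_summable_integral_norm hFi hFs).tsum_eq
  have e1 : ∀ i, u i * φ (x i) = ∫ y, F i y := by
    intro i
    rw [hφ, ← integral_const_mul]
  simp only [e1]
  rw [key]
  have e2 : ∀ y, ‖∑' i, F i y‖ ≤ B * ‖h y‖ := by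
    intro y
    have : ∑' i, F i y = h y * ∑' i, u i * transRefl (-y) ψ (x i) := by
      rw [← tsum_mul_left, ← σ.tsum_eq]
      refine tsum_congr fun i => ?_
      simp only [hF, hσu, hσx, transRefl_apply]
      rw [show - x i - y = - y - x i by ring]
      ring
    rw [this, norm_mul, mul_comm]
    exact mul_le_mul_of_nonneg_right (hB _) (norm_nonneg _)
  rw [← integral_const_mul]
  exact norm_integral_le_of_norm_le (h.integrable.norm.const_mul B) (Eventually.of_forall e2)

end final

/-- There exists a crystalline measure on `ℝ` such that neither it nor
its Fourier transform is translation bounded as a tempered distribution; in particular,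
neither is strongly tempered. -/
theorem exists_crystalline_not_transBddTD :
    ∃ (μ ν : CMeasure ℝ) (T : SchwartzMap ℝ ℂ →L[ℂ] ℂ),
      μ.Agrees T ∧ ν.Agrees (fourierTD T) ∧
      μ.IsPurePoint ∧ ν.IsPurePoint ∧
      μ.LocallyFiniteSupport ∧ ν.LocallyFiniteSupport ∧
      ¬ TransBddTD T ∧ ¬ TransBddTD (fourierTD T) ∧
      ¬ μ.IsStronglyTempered ∧ ¬ ν.IsStronglyTempered := by
  classical
  obtain ⟨u, x, V, W, σ, hVs, hV0, hu, hσu, hσx, hLF, hWn, hrep⟩ := combine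
  obtain ⟨U, hU, hUs, hUb⟩ := exists_U hVs hV0 hu
  have hUev : ∀ φ η : SchwartzMap ℝ ℂ, (∀ y, η y = φ (-y)) → U η = U φ := by
    intro φ η h
    rw [hU, hU, ← σ.tsum_eq]
    refine tsum_congr fun i => ?_
    rw [hσu, h, hσx, neg_neg]
  set T : SchwartzMap ℝ ℂ →L[ℂ] ℂ := U + U.comp (SchwartzMap.fourierTransformCLM ℂ) with hT
  have hTa : ∀ φ, T φ = U φ + U (FourierTransform.fourier φ) := fun φ => rfl
  have hFa : ∀ φ, fourierTD T φ = T (FourierTransform.fourier φ) := fun φ => rfl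
  have hFT : fourierTD T = T := by
    ext φ
    rw [hFa, hTa, hTa, add_comm]
    congr 1
    exact hUev _ _ (fourier_fourier φ)
  have hTW : ∀ φ : SchwartzMap ℝ ℂ, IsTestFn φ → HasSum (fun y => W y * φ y) (T φ) := by
    intro φ hφ
    rw [hTa, hU, hU]
    exact hrep φ hφ
  have hag : (wM W hLF).Agrees T := fun φ hφ => (hTW φ hφ).unique (wM_pairing W hLF φ hφ)
  have hnst : ¬ (wM W hLF).IsStronglyTempered := by
    apply wM_not_strong
    intro n
    rw [hWn, Complex.norm_real, Real.norm_eq_abs, abs_of_nonneg (by positivity)]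
    refine le_mul_of_one_le_left (Real.exp_pos _).le ?_
    have : (0 : ℝ) ≤ n := n.cast_nonneg
    linarith
  have hntb : ¬ TransBddTD T := by
    intro htb
    obtain ⟨g, hg⟩ := exists_gauss
    set ψ : SchwartzMap ℝ ℂ := FourierTransformInv.fourierInv g with hψ
    have hψg : FourierTransform.fourier ψ = g :=
      FourierTransform.fourier_fourierInv_eq (F := SchwartzMap ℝ ℂ) g
    set Vs : ℝ := ∑' i, V i with hVsd
    set Cg : ℝ := SchwartzMap.seminorm ℂ 4 0 g with hCg
    obtain ⟨B, hB⟩ := htb ψ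
    have hB1 : ∀ y, ‖∑' i, u i * transRefl y ψ (x i)‖ ≤ B + Vs * Cg := by
      intro y
      rw [← hU]
      have h1 : ‖U (FourierTransform.fourier (transRefl y ψ))‖ ≤ Vs * Cg := by
        apply hUb
        intro ξ
        rw [fourier_affine (-1) y (by norm_num) ψ (transRefl y ψ)
          (fun z => by rw [transRefl_apply]; congr 1; ring), hψg, norm_mul, norm_mul, exp_norm_one]
        have := schwartz_bd g 4 (ξ / (-1))
        simpa [abs_div] using this
      have h2 : ‖T (transRefl y ψ)‖ ≤ B := hB y
      have h3 : U (transRefl y ψ) =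
          T (transRefl y ψ) - U (FourierTransform.fourier (transRefl y ψ)) := by
        rw [hTa]; ring
      rw [h3]
      exact (norm_sub_le _ _).trans (add_le_add h2 h1)
    obtain ⟨χ, hχ0, hχ1, hχs⟩ := exists_bump
    set C1 : ℝ := ∫ y, ‖FourierTransform.fourier χ y‖ with hC1
    have main : ∀ n : ℕ, (n : ℝ) + 1 ≤ (B + Vs * Cg) * C1 + Vs * Cg := by
      intro n
      set c : ℝ := ((2 * n + 2 : ℕ) : ℝ) with hc
      obtain ⟨δ, hδ, hδW⟩ : ∃ δ : ℝ, 0 < δ ∧ ∀ y, |y - c| < δ → y ≠ c → W y = 0 := by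
        have hfin : ({y : ℝ | |y| ≤ |c| + 1 ∧ W y ≠ 0} \ {c}).Finite := (hLF _).subset Set.sdiff_subset
        have hop : ({y : ℝ | |y| ≤ |c| + 1 ∧ W y ≠ 0} \ {c})ᶜ ∈ 𝓝 c :=
          hfin.isClosed.isOpen_compl.mem_nhds (by simp)
        obtain ⟨δ, hδ, hs⟩ := Metric.mem_nhds_iff.1 hop
        refine ⟨min δ 1, lt_min hδ one_pos, fun y hy hyc => ?_⟩
        by_contra hW
        refine hs (show y ∈ Metric.ball c δ from ?_) ⟨⟨?_, hW⟩, hyc⟩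
        · rw [Metric.mem_ball, Real.dist_eq]; exact hy.trans_le (min_le_left _ _)
        · have h1 := hy.trans_le (min_le_right _ _)
          have h2 := abs_sub_abs_le_abs_sub y c
          linarith
      obtain ⟨h, φ, hφ, hφf, hhn⟩ := exists_conv χ ψ c δ hδ
      rw [hψg] at hφf
      have hzero : ∀ y, δ ≤ |y - c| → FourierTransform.fourier φ y = 0 := by
        intro y hy
        rw [hφf, hχs, zero_mul]
        rw [show δ⁻¹ * y + -(δ⁻¹ * c) = δ⁻¹ * (y - c) by ring, abs_mul, abs_of_pos (inv_pos.2 hδ)]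
        rw [← div_eq_inv_mul, le_div_iff₀ hδ]
        linarith
      have htest : IsTestFn (FourierTransform.fourier φ) := by
        refine HasCompactSupport.intro (isCompact_closedBall c δ) fun y hy => hzero y ?_
        rw [Metric.mem_closedBall, Real.dist_eq] at hy
        linarith
      have hval : T (FourierTransform.fourier φ) = ((n : ℝ) + 1 : ℝ) := by
        refine (hTW _ htest).unique ?_
        have : ∀ y, y ≠ c → W y * FourierTransform.fourier φ y = 0 := by
          intro y hy
          by_cases hd : |y - c| < δ
          · rw [hδW y hd hy, zero_mul]
          · rw [hzero y (not_lt.1 hd), mul_zero]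
        have hs := hasSum_single c this
        convert hs using 1
        rw [hφf, hg, hc, hWn, ← hc, show δ⁻¹ * c + -(δ⁻¹ * c) = 0 by ring, hχ0, one_mul,
          ← Complex.ofReal_mul, mul_assoc, ← Real.exp_add, add_neg_cancel, Real.exp_zero, mul_one]
      have hval2 : T φ = ((n : ℝ) + 1 : ℝ) := by
        rw [← hval, ← hFa, hFT]
      have hb1 : ‖U φ‖ ≤ (B + Vs * Cg) * C1 := by
        rw [hU, hC1, ← hhn]
        exact conv_bound hVs hV0 hu σ hσu hσx h φ ψ hφ _ hB1
      have hb2 : ‖U (FourierTransform.fourier φ)‖ ≤ Vs * Cg := by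
        apply hUb
        intro y
        rw [hφf, norm_mul]
        refine le_trans ?_ (schwartz_bd g 4 y)
        gcongr
        exact mul_le_of_le_one_left (norm_nonneg _) (hχ1 _)
      have h5 : ‖T φ‖ = (n : ℝ) + 1 := by
        rw [hval2, Complex.norm_real, Real.norm_eq_abs, abs_of_nonneg (by positivity)]
      rw [← h5, hTa]
      exact (norm_add_le _ _).trans (add_le_add hb1 hb2)
    obtain ⟨N, hN⟩ := exists_nat_ge ((B + Vs * Cg) * C1 + Vs * Cg)
    linarith [main N]
  have hlf := wM_lf W hLF
  exact ⟨wM W hLF, wM W hLF, T, hag, by rw [hFT]; exact hag, hlf.1, hlf.1, hlf.2, hlf.2,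
    hntb, by rw [hFT]; exact hntb, hnst, hnst⟩
end
end

section
/- Fix m ∈ ℕ, m ≥ 1. Let μ be a pure-point measure on ℝ supported in (1/m)ℤ that is mℤ-periodic (τ_n μ = μ for every n ∈ mℤ) and whose atoms satisfy |μ({x})| ≤ 1 for all x. Let f ∈ C¹(ℝ) with ‖(1+x²)f′(x)‖_∞ < ∞. Then, for every t ∈ (0,1), the (absolutely convergent) sum (τ_t μ − μ)(f) = Σ_x μ({x})(f(x+t) − f(x)) satisfies |(τ_t μ − μ)(f)| ≤ t · (4m² + m) · ‖(1+x²)f′(x)‖_∞. -/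
noncomputable section

lemma aux_sum (m : ℕ) (hm : 1 ≤ m) (N : ℕ) :
    ∑ k ∈ Finset.range N, 1 / (1 + ((k : ℝ) / m) ^ 2) ≤ 1 + 3 / 2 * (m : ℝ) ^ 2 := by
  have hm' : (1 : ℝ) ≤ m := by exact_mod_cast hm
  have key : ∀ N : ℕ, ∑ k ∈ Finset.range (N + 2), 1 / (1 + ((k : ℝ) / m) ^ 2)
      ≤ 1 + (m : ℝ) ^ 2 * (3 / 2 - 1 / ((N : ℝ) + 1)) := by
    intro N
    induction N with
    | zero =>
      simp only [Finset.sum_range_succ, Finset.sum_range_zero]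
      have : 1 / (1 + (((1 : ℕ) : ℝ) / m) ^ 2) ≤ (m : ℝ) ^ 2 * (1 / 2) := by
        rw [div_le_iff₀ (by positivity)]
        have : (m : ℝ) ^ 2 * (1 / 2) * (1 + (((1 : ℕ) : ℝ) / m) ^ 2) = ((m : ℝ) ^ 2 + 1) / 2 := by
          push_cast
          field_simp
        rw [this]
        nlinarith
      norm_num at this ⊢
      linarith
    | succ n ih =>
      rw [Finset.sum_range_succ]
      have : 1 / (1 + (((n + 2 : ℕ) : ℝ) / m) ^ 2)
          ≤ (m : ℝ) ^ 2 * (1 / ((n : ℝ) + 1) - 1 / ((n : ℝ) + 2)) := by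
        have e1 : 1 / (1 + (((n + 2 : ℕ) : ℝ) / m) ^ 2)
            = (m : ℝ) ^ 2 * (1 / ((m : ℝ) ^ 2 + ((n : ℝ) + 2) ^ 2)) := by
          push_cast
          field_simp
        have e2 : 1 / ((n : ℝ) + 1) - 1 / ((n : ℝ) + 2) = 1 / (((n : ℝ) + 1) * ((n : ℝ) + 2)) := by
          field_simp
          ring
        rw [e1, e2]
        have hn : (0 : ℝ) ≤ n := by positivity
        gcongr
        nlinarith
      have e3 : (((n + 1 : ℕ) : ℝ) + 1) = (n : ℝ) + 2 := by push_cast; ring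
      rw [e3]
      rw [show n + 1 + 1 = n + 2 from rfl]
      linarith
  calc ∑ k ∈ Finset.range N, 1 / (1 + ((k : ℝ) / m) ^ 2)
      ≤ ∑ k ∈ Finset.range (N + 2), 1 / (1 + ((k : ℝ) / m) ^ 2) := by
        apply Finset.sum_le_sum_of_subset_of_nonneg
        · intro x; simp; omega
        · intros; positivity
    _ ≤ _ := key N
    _ ≤ _ := by
        have : 0 ≤ (m : ℝ) ^ 2 * (1 / ((N : ℝ) + 1)) := by positivity
        linarith

lemma aux_mvt (f : ℝ → ℂ) (hf : ContDiff ℝ 1 f)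
    (C : ℝ) (hC : ∀ x : ℝ, (1 + x ^ 2) * ‖deriv f x‖ ≤ C)
    (t : ℝ) (ht : t ∈ Set.Ioo (0 : ℝ) 1) (c : ℂ) (hc : ‖c‖ ≤ 1) (x d : ℝ)
    (hd : ∀ y ∈ Set.Icc x (x + t), d ^ 2 ≤ y ^ 2) :
    ‖c * (f (x + t) - f x)‖ ≤ t * C * (1 / (1 + d ^ 2)) := by
  have ht0 := ht.1
  have h := Convex.norm_image_sub_le_of_norm_deriv_le (𝕜 := ℝ) (f := f) (C := C * (1 / (1 + d ^ 2)))
    (s := Set.Icc x (x + t)) (x := x) (y := x + t)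
    (fun y _ => (hf.differentiable one_ne_zero) y)
    (by
      intro y hy
      rw [mul_one_div, le_div_iff₀ (by positivity)]
      have := hd y hy
      have h2 := norm_nonneg (deriv f y)
      nlinarith [hC y])
    (convex_Icc _ _) ⟨le_rfl, by linarith⟩ ⟨by linarith, le_rfl⟩
  rw [norm_mul]
  have e : ‖x + t - x‖ = t := by rw [add_sub_cancel_left, Real.norm_of_nonneg ht0.le]
  rw [e] at h
  calc ‖c‖ * ‖f (x + t) - f x‖ ≤ 1 * ‖f (x + t) - f x‖ := by gcongr
    _ ≤ _ := by linarith

lemma aux_neg (m : ℕ) (hm : 1 ≤ m) (t C : ℝ) (htC : 0 ≤ t * C) (F : ℤ → ℂ)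
    (hneg1 : ∀ n : ℕ, ‖F (-((n : ℤ) + 1))‖ ≤ t * C)
    (hneg2 : ∀ n : ℕ, ‖F (-(((m - 1 + n : ℕ) : ℤ) + 1))‖
      ≤ t * C * (1 / (1 + ((n : ℝ) / m) ^ 2))) :
    ∀ N : ℕ, ∑ n ∈ Finset.range N, ‖F (-((n : ℤ) + 1))‖
      ≤ t * C * ((m : ℝ) - 1) + t * C * (1 + 3 / 2 * (m : ℝ) ^ 2) := by
    intro N
    calc ∑ n ∈ Finset.range N, ‖F (-((n : ℤ) + 1))‖
        ≤ ∑ n ∈ Finset.range (m - 1 + N), ‖F (-((n : ℤ) + 1))‖ := by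
          apply Finset.sum_le_sum_of_subset_of_nonneg
          · intro x; simp; omega
          · intros; exact norm_nonneg _
      _ = ∑ n ∈ Finset.range (m - 1), ‖F (-((n : ℤ) + 1))‖
          + ∑ n ∈ Finset.range N, ‖F (-(((m - 1 + n : ℕ) : ℤ) + 1))‖ :=
          Finset.sum_range_add (fun n : ℕ => ‖F (-((n : ℤ) + 1))‖) (m - 1) N
      _ ≤ ∑ n ∈ Finset.range (m - 1), t * C
          + ∑ n ∈ Finset.range N, t * C * (1 / (1 + ((n : ℝ) / m) ^ 2)) :=
          add_le_add (Finset.sum_le_sum fun n _ => hneg1 n) (Finset.sum_le_sum fun n _ => hneg2 n)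
      _ ≤ _ := by
          rw [Finset.sum_const, Finset.card_range, nsmul_eq_mul,
            Nat.cast_sub hm, Nat.cast_one, mul_comm _ (t * C), ← Finset.mul_sum]
          exact add_le_add le_rfl (mul_le_mul_of_nonneg_left (aux_sum m hm N) htC)

lemma aux_main (m : ℕ) (hm : 1 ≤ m) (hm' : (1 : ℝ) ≤ m) (t C : ℝ) (htC : 0 ≤ t * C) (F : ℤ → ℂ)
    (hpos : ∀ n : ℕ, ‖F (n : ℤ)‖ ≤ t * C * (1 / (1 + ((n : ℝ) / m) ^ 2)))
    (hneg1 : ∀ n : ℕ, ‖F (-((n : ℤ) + 1))‖ ≤ t * C)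
    (hneg2 : ∀ n : ℕ, ‖F (-(((m - 1 + n : ℕ) : ℤ) + 1))‖
      ≤ t * C * (1 / (1 + ((n : ℝ) / m) ^ 2))) :
    Summable (fun j : ℤ => ‖F j‖) ∧
    ‖∑' j : ℤ, F j‖ ≤ t * (4 * (m : ℝ) ^ 2 + (m : ℝ)) * C := by
  have spos : ∀ N : ℕ, ∑ n ∈ Finset.range N, ‖F (n : ℤ)‖ ≤ t * C * (1 + 3 / 2 * (m : ℝ) ^ 2) := by
    intro N
    refine (Finset.sum_le_sum fun n _ => hpos n).trans ?_
    rw [← Finset.mul_sum]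
    exact mul_le_mul_of_nonneg_left (aux_sum m hm N) htC
  have sneg := aux_neg m hm t C htC F hneg1 hneg2
  have S1 : Summable fun n : ℕ => ‖F (n : ℤ)‖ :=
    summable_of_sum_range_le (fun n : ℕ => norm_nonneg (F (n : ℤ))) spos
  have S2 : Summable fun n : ℕ => ‖F (-((n : ℤ) + 1))‖ :=
    summable_of_sum_range_le (fun n : ℕ => norm_nonneg (F (-((n : ℤ) + 1)))) sneg
  have S : Summable fun j : ℤ => ‖F j‖ :=
    Summable.of_nat_of_neg_add_one (f := fun j : ℤ => ‖F j‖) S1 S2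
  refine ⟨S, (norm_tsum_le_tsum_norm S).trans ?_⟩
  rw [tsum_of_nat_of_neg_add_one (f := fun j : ℤ => ‖F j‖) S1 S2]
  have b1 : ∑' n : ℕ, ‖F (n : ℤ)‖ ≤ t * C * (1 + 3 / 2 * (m : ℝ) ^ 2) := Real.tsum_le_of_sum_range_le (fun n : ℕ => norm_nonneg (F (n : ℤ))) spos
  have b2 : ∑' n : ℕ, ‖F (-((n : ℤ) + 1))‖
      ≤ t * C * ((m : ℝ) - 1) + t * C * (1 + 3 / 2 * (m : ℝ) ^ 2) := Real.tsum_le_of_sum_range_le (fun n : ℕ => norm_nonneg (F (-((n : ℤ) + 1)))) sneg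
  have : 0 ≤ t * C * ((m : ℝ) ^ 2 - 1) := mul_nonneg htC (sub_nonneg.2 (one_le_pow₀ hm'))
  have e : t * (4 * (m : ℝ) ^ 2 + (m : ℝ)) * C = t * C * (1 + 3 / 2 * (m : ℝ) ^ 2)
      + (t * C * ((m : ℝ) - 1) + t * C * (1 + 3 / 2 * (m : ℝ) ^ 2))
      + t * C * ((m : ℝ) ^ 2 - 1) := by ring
  rw [e]
  exact (add_le_add b1 b2).trans (le_add_of_nonneg_right this)

/-- Let `μ = Σ c(x) δ_x` be a pure-point measure on `ℝ` supported in
`(1/m)ℤ`, `mℤ`-periodic, with atoms of modulus at most `1`. For `f ∈ C¹(ℝ)` with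
`‖(1+x²)f'(x)‖_∞ ≤ C` and `t ∈ (0,1)`, the sum
`(τ_t μ - μ)(f) = Σ_x μ({x})(f(x+t) - f(x))` converges absolutely and satisfies
`|(τ_t μ - μ)(f)| ≤ t·(4m² + m)·C`. -/
theorem periodic_comb_translate_estimate
    (m : ℕ) (hm : 1 ≤ m) (c : ℝ → ℂ)
    (hsupp : ∀ x : ℝ, c x ≠ 0 → ∃ j : ℤ, x = (j : ℝ) / (m : ℝ))
    (hper : ∀ x : ℝ, c (x + (m : ℝ)) = c x)
    (hbd : ∀ x : ℝ, ‖c x‖ ≤ 1)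
    (f : ℝ → ℂ) (hf : ContDiff ℝ 1 f)
    (C : ℝ) (hC : ∀ x : ℝ, (1 + x ^ 2) * ‖deriv f x‖ ≤ C)
    (t : ℝ) (ht : t ∈ Set.Ioo (0 : ℝ) 1) :
    Summable (fun j : ℤ =>
      ‖c ((j : ℝ) / (m : ℝ)) * (f ((j : ℝ) / (m : ℝ) + t) - f ((j : ℝ) / (m : ℝ)))‖) ∧
    ‖∑' j : ℤ, c ((j : ℝ) / (m : ℝ)) * (f ((j : ℝ) / (m : ℝ) + t) - f ((j : ℝ) / (m : ℝ)))‖ ≤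
      t * (4 * (m : ℝ) ^ 2 + (m : ℝ)) * C := by
  have ht0 := ht.1
  have ht1 := ht.2
  have hm' : (1 : ℝ) ≤ m := by exact_mod_cast hm
  have hC0 : 0 ≤ C := le_trans (by positivity) (hC 0)
  have htC : 0 ≤ t * C := by positivity
  set F : ℤ → ℂ := fun j : ℤ =>
    c ((j : ℝ) / (m : ℝ)) * (f ((j : ℝ) / (m : ℝ) + t) - f ((j : ℝ) / (m : ℝ))) with hF
  have hpos : ∀ n : ℕ, ‖F (n : ℤ)‖ ≤ t * C * (1 / (1 + ((n : ℝ) / m) ^ 2)) := by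
    intro n
    apply aux_mvt f hf C hC t ht _ (hbd _)
    intro y hy
    have h0 : (0 : ℝ) ≤ (n : ℝ) / m := by positivity
    have := hy.1
    push_cast at this
    gcongr
  have hneg1 : ∀ n : ℕ, ‖F (-((n : ℤ) + 1))‖ ≤ t * C := by
    intro n
    have h : ‖F (-((n : ℤ) + 1))‖ ≤ t * C * (1 / (1 + (0 : ℝ) ^ 2)) := by
      apply aux_mvt f hf C hC t ht _ (hbd _)
      intro y _
      rw [zero_pow two_ne_zero]
      exact sq_nonneg y
    have e : (1 : ℝ) / (1 + (0 : ℝ) ^ 2) = 1 := by norm_num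
    rwa [e, mul_one] at h
  have hneg2 : ∀ n : ℕ, ‖F (-(((m - 1 + n : ℕ) : ℤ) + 1))‖
      ≤ t * C * (1 / (1 + ((n : ℝ) / m) ^ 2)) := by
    intro n
    apply aux_mvt f hf C hC t ht _ (hbd _)
    intro y hy
    have h0 : (0 : ℝ) ≤ (n : ℝ) / m := by positivity
    have e : (((-(((m - 1 + n : ℕ) : ℤ) + 1) : ℤ)) : ℝ) / m = -1 - (n : ℝ) / m := by
      push_cast [Nat.cast_sub hm]
      field_simp
      ring
    have := hy.2
    rw [e] at this
    nlinarith
  exact aux_main m hm hm' t C htC F hpos hneg1 hneg2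
end
end
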